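/- arXiv:1503.01705 — 6 statements merged into one kernel-verified Lean document; each statement's English description precedes it below -/
import Mathlib

section
/- Let F_k be a free group of finite rank k, let H ≤ F_k be a subgroup, and let w_1, …, w_m ∈ H be nontrivial elements. Then there exists a nontrivial element w ∈ H such that every normal subgroup N of F_k that contains at least one of the w_i also contains w. -/
namespace FreeGroup

theorem eq_of_commute_of {α : Type*} {a b : α} (h : Commute (of a) (of b)) : a = b := by
  classical
  by_contra hab
  have h' := congrArg toWord h.eq
  simp [toWord_mul, reduce.cons, hab] at h'

theorem isCyclic_of_commute {α : Type*} (h : ∀ x y : FreeGroup α, Commute x y) :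
    IsCyclic (FreeGroup α) := by
  have : Subsingleton α := ⟨fun a b => eq_of_commute_of (h _ _)⟩
  cases isEmpty_or_nonempty α with
  | inl _ => infer_instance
  | inr _ =>
    have := Classical.inhabited_of_nonempty ‹Nonempty α›
    have := Unique.mk' α
    infer_instance

end FreeGroup

theorem IsFreeGroup.isCyclic_of_commute {G : Type*} [Group G] [IsFreeGroup G]
    (h : ∀ x y : G, Commute x y) : IsCyclic G := by
  have := FreeGroup.isCyclic_of_commute (α := Generators G) fun x y => by
    simpa using (h ((toFreeGroup G).symm x) ((toFreeGroup G).symm y)).map (toFreeGroup G)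
  exact (toFreeGroup G).isCyclic.2 this

namespace FreeGroup

open scoped commutatorElement

theorem exists_zpow_eq_of_commute {α : Type*} {u v : FreeGroup α} (h : Commute u v) :
    ∃ (c : FreeGroup α) (p q : ℤ), c ^ p = u ∧ c ^ q = v := by
  have hcomm : IsMulCommutative (Subgroup.closure {u, v}) := by
    apply Subgroup.isMulCommutative_closure
    rintro x (rfl | rfl) y (rfl | rfl)
    exacts [rfl, h.eq, h.eq.symm, rfl]
  obtain ⟨c, hc⟩ := (IsFreeGroup.isCyclic_of_commute
    (G := Subgroup.closure {u, v}) hcomm.is_comm.comm).exists_generator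
  obtain ⟨p, hp⟩ := hc ⟨u, Subgroup.subset_closure (by simp)⟩
  obtain ⟨q, hq⟩ := hc ⟨v, Subgroup.subset_closure (by simp)⟩
  exact ⟨c, p, q, congrArg Subtype.val hp, congrArg Subtype.val hq⟩

theorem exists_ne_one_mem_of_mem_or_mem {α : Type*} {H : Subgroup (FreeGroup α)}
    {u v : FreeGroup α} (huH : u ∈ H) (hvH : v ∈ H) (hu : u ≠ 1) (hv : v ≠ 1) :
    ∃ x ∈ H, x ≠ 1 ∧ ∀ N : Subgroup (FreeGroup α), N.Normal → u ∈ N ∨ v ∈ N → x ∈ N := by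
  by_cases h : Commute u v
  · obtain ⟨c, p, q, rfl, rfl⟩ := exists_zpow_eq_of_commute h
    have hq : q ≠ 0 := by rintro rfl; simp at hv
    refine ⟨(c ^ p) ^ q, H.zpow_mem huH q, fun h1 => hu ?_, ?_⟩
    · exact zpow_left_injective hq (by simpa using h1)
    · rintro N - (hN | hN)
      · exact N.zpow_mem hN q
      · rw [zpow_comm]
        exact N.zpow_mem hN p
  · refine ⟨⁅u, v⁆, ?_, fun h1 => h (commutatorElement_eq_one_iff_commute.1 h1), ?_⟩
    · exact H.mul_mem (H.mul_mem (H.mul_mem huH hvH) (H.inv_mem huH)) (H.inv_mem hvH)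
    · rintro N hN (hu | hv)
      · rw [commutatorElement_def, mul_assoc, mul_assoc, ← mul_assoc v]
        exact N.mul_mem hu (hN.conj_mem _ (N.inv_mem hu) v)
      · exact N.mul_mem (hN.conj_mem _ hv u) (N.inv_mem hv)

theorem exists_ne_one_mem_of_exists_mem {α ι : Type*} {H : Subgroup (FreeGroup α)}
    {w : ι → FreeGroup α} (hwH : ∀ i, w i ∈ H) (hw1 : ∀ i, w i ≠ 1) {s : Finset ι}
    (hs : s.Nonempty) :
    ∃ v ∈ H, v ≠ 1 ∧ ∀ N : Subgroup (FreeGroup α), N.Normal → (∃ i ∈ s, w i ∈ N) → v ∈ N := by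
  induction hs using Finset.Nonempty.cons_induction with
  | singleton a => exact ⟨w a, hwH a, hw1 a, by simp⟩
  | cons a s _ _ ih =>
    obtain ⟨v, hvH, hv1, hv⟩ := ih
    obtain ⟨x, hxH, hx1, hx⟩ := exists_ne_one_mem_of_mem_or_mem (hwH a) hvH (hw1 a) hv1
    refine ⟨x, hxH, hx1, fun N hN h => hx N hN ?_⟩
    simp only [Finset.mem_cons, exists_eq_or_imp] at h
    exact h.imp_right (hv N hN)

end FreeGroup


/-- Let `F_k` be a free group of finite rank `k`, `H ≤ F_k` a subgroup, and
`w 1, …, w m ∈ H` nontrivial elements.  Then there is a nontrivial `v ∈ H` such that every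
normal subgroup `N` of `F_k` containing some `w i` also contains `v`. -/
theorem stmt_0 (k m : ℕ) (hm : 0 < m) (H : Subgroup (FreeGroup (Fin k)))
    (w : Fin m → FreeGroup (Fin k)) (hwH : ∀ i, w i ∈ H) (hw1 : ∀ i, w i ≠ 1) :
    ∃ v : FreeGroup (Fin k), v ∈ H ∧ v ≠ 1 ∧
      ∀ N : Subgroup (FreeGroup (Fin k)), N.Normal → (∃ i, w i ∈ N) → v ∈ N := by
  have : Nonempty (Fin m) := ⟨⟨0, hm⟩⟩
  obtain ⟨v, hvH, hv1, hv⟩ := FreeGroup.exists_ne_one_mem_of_exists_mem hwH hw1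
    Finset.univ_nonempty
  exact ⟨v, hvH, hv1, fun N hN h => hv N hN (by simpa using h)⟩
end

section
/- Let k ≥ 1 and let 𝒞 be a closed set of normal subgroups of the free group F_k (closed in the space S(F_k) of subgroups). Assume that for every N ∈ 𝒞 the quotient group F_k/N contains no nonabelian free subgroup, i.e., there is no injective group homomorphism from the free group of rank 2 into F_k/N. Then the quotient F_k/(⋂_{N ∈ 𝒞} N) also admits no injective group homomorphism from the free group of rank 2. -/
/- The characteristic function of a subgroup, as an element of `{0,1}^G`. -/
open Classical in
noncomputable def subgroupChar {G : Type*} [Group G] (N : Subgroup G) : G → Bool :=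
  fun g => decide (g ∈ N)

/-- The topology on the space `S(G)` of subgroups of `G`, induced from the product
(Tychonoff) topology on `{0,1}^G` via characteristic functions. -/
noncomputable instance {G : Type*} [Group G] : TopologicalSpace (Subgroup G) :=
  TopologicalSpace.induced subgroupChar inferInstance

/-- The quotient group `G ⧸ N` for a normal subgroup `N`, with the normality proof
supplied explicitly (so that it can be used under binders). -/
def QuotGrp {G : Type*} [Group G] (N : Subgroup G) (_h : N.Normal) : Type _ := G ⧸ N

noncomputable instance QuotGrp.instGroup {G : Type*} [Group G] (N : Subgroup G) (h : N.Normal) :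
    Group (QuotGrp N h) := @QuotientGroup.Quotient.group G _ N h

namespace FreeGroup

theorem subsingleton_of_mul_comm {α : Type*} (h : ∀ a b : FreeGroup α, a * b = b * a) :
    Subsingleton α := by
  classical
  refine ⟨fun x y => ?_⟩
  have hxy := congrArg toWord (h (of x) (of y))
  have hred : ∀ a b : α, toWord (of a * of b) = [(a, true), (b, true)] := fun a b => by
    simp [toWord_mul, reduce]
  rw [hred, hred] at hxy
  simpa using congrArg List.head? hxy

theorem isCyclic_of_mul_comm {α : Type*} (h : ∀ a b : FreeGroup α, a * b = b * a) :
    IsCyclic (FreeGroup α) := by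
  have := subsingleton_of_mul_comm h
  rcases isEmpty_or_nonempty α with _ | ⟨⟨x⟩⟩
  · infer_instance
  · have := uniqueOfSubsingleton x
    infer_instance

end FreeGroup

theorem IsFreeGroup.isCyclic_of_mul_comm {G : Type*} [Group G] [IsFreeGroup G]
    (h : ∀ a b : G, a * b = b * a) : IsCyclic G := by
  let e := IsFreeGroup.mulEquiv G
  have := FreeGroup.isCyclic_of_mul_comm fun a b => e.injective (by simp [h])
  exact isCyclic_of_surjective e e.surjective

namespace FreeGroup

/-- Two commuting elements of a free group are powers of a common element. -/
theorem exists_zpow_of_commute {α : Type*} {u v : FreeGroup α} (h : Commute u v) :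
    ∃ (g : FreeGroup α) (m n : ℤ), g ^ m = u ∧ g ^ n = v := by
  let H := Subgroup.closure {u, v}
  have hcomm : ∀ x ∈ ({u, v} : Set (FreeGroup α)), ∀ y ∈ ({u, v} : Set (FreeGroup α)),
      x * y = y * x := by
    rintro x (rfl | rfl) y (rfl | rfl)
    exacts [rfl, h.eq, h.eq.symm, rfl]
  have := Subgroup.isMulCommutative_closure hcomm
  have hH : ∀ a b : H, a * b = b * a := mul_comm'
  obtain ⟨g, hg⟩ := (IsFreeGroup.isCyclic_of_mul_comm hH).exists_generator
  obtain ⟨m, hm⟩ := hg ⟨u, Subgroup.subset_closure (by simp)⟩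
  obtain ⟨n, hn⟩ := hg ⟨v, Subgroup.subset_closure (by simp)⟩
  exact ⟨g, m, n, congrArg Subtype.val hm, congrArg Subtype.val hn⟩

/-- Any two nontrivial normal subgroups of a free group intersect nontrivially. -/
theorem exists_ne_one_mem_normalClosure {α : Type*} {u v : FreeGroup α}
    (hu : u ≠ 1) (hv : v ≠ 1) :
    ∃ w ≠ 1, w ∈ Subgroup.normalClosure {u} ∧ w ∈ Subgroup.normalClosure {v} := by
  have hu' : u ∈ Subgroup.normalClosure {u} := Subgroup.subset_normalClosure rfl
  have hv' : v ∈ Subgroup.normalClosure {v} := Subgroup.subset_normalClosure rfl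
  by_cases h : Commute u v
  · obtain ⟨g, m, n, rfl, rfl⟩ := exists_zpow_of_commute h
    have hn : n ≠ 0 := by rintro rfl; simp at hv
    refine ⟨(g ^ m) ^ n, fun h1 => hu ((IsMulTorsionFree.zpow_eq_one_iff_left hn).1 h1),
      zpow_mem hu' n, ?_⟩
    rw [zpow_comm]
    exact zpow_mem hv' m
  · refine ⟨u * v * u⁻¹ * v⁻¹,
      fun h1 => h (mul_inv_eq_iff_eq_mul.1 (mul_inv_eq_one.1 h1)), ?_, ?_⟩
    · rw [mul_assoc, mul_assoc, ← mul_assoc v]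
      exact mul_mem hu' (Subgroup.normalClosure_normal.conj_mem _ (inv_mem hu') v)
    · exact mul_mem (Subgroup.normalClosure_normal.conj_mem _ hv' u) (inv_mem hv')

end FreeGroup

theorem subgroupChar_eq_true {G : Type*} [Group G] {N : Subgroup G} {g : G} :
    subgroupChar N g = true ↔ g ∈ N := by
  simp [subgroupChar]

theorem isClosed_range_subgroupChar {G : Type*} [Group G] :
    IsClosed (Set.range (subgroupChar (G := G))) := by
  have hrange : Set.range (subgroupChar (G := G)) =
      {f | f 1 = true} ∩ ((⋂ a, ⋂ b, {f | (f a && f b && !f (a * b)) = false}) ∩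
        ⋂ a, {f | (f a && !f a⁻¹) = false}) := by
    ext f
    simp only [Set.mem_inter_iff, Set.mem_iInter, Set.mem_ofPred_eq]
    constructor
    · rintro ⟨N, rfl⟩
      refine ⟨subgroupChar_eq_true.2 N.one_mem, fun a b => ?_, fun a => ?_⟩
      · have := N.mul_mem (x := a) (y := b)
        simpa [subgroupChar, imp_iff_not_or, or_assoc] using this
      · simp [subgroupChar]
    · rintro ⟨h1, hmul, hinv⟩
      refine ⟨⟨⟨⟨{g | f g = true}, fun {a b} ha hb => ?_⟩, h1⟩, fun {a} ha => ?_⟩, ?_⟩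
      · simpa [show f a = true from ha, show f b = true from hb] using hmul a b
      · simpa [show f a = true from ha] using hinv a
      · funext g
        rw [Bool.eq_iff_iff, subgroupChar_eq_true]
        rfl
  have hc (s : Bool → Bool → Bool → Bool) (a b c : G) :
      Continuous fun f : G → Bool => s (f a) (f b) (f c) :=
    (continuous_of_discreteTopology (f := fun p : Bool × Bool × Bool => s p.1 p.2.1 p.2.2)).comp
      (by fun_prop : Continuous fun f : G → Bool => (f a, f b, f c))
  rw [hrange]
  exact (isClosed_eq (continuous_apply 1) continuous_const).inter
    (.inter
      (isClosed_iInter fun a => isClosed_iInter fun b =>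
        isClosed_eq (hc (fun x y z => x && y && !z) a b (a * b)) continuous_const)
      (isClosed_iInter fun a =>
        isClosed_eq (hc (fun x y _ => x && !y) a a⁻¹ a) continuous_const))

instance Subgroup.instCompactSpace {G : Type*} [Group G] : CompactSpace (Subgroup G) := by
  have hind : Topology.IsInducing (subgroupChar (G := G)) := ⟨rfl⟩
  refine ⟨hind.isCompact_iff.2 ?_⟩
  rw [Set.image_univ]
  exact isClosed_range_subgroupChar.isCompact

theorem Subgroup.isOpen_setOf_mem {G : Type*} [Group G] (g : G) :
    IsOpen {N : Subgroup G | g ∈ N} := by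
  have hcont : Continuous fun N : Subgroup G => subgroupChar N g :=
    (continuous_apply (A := fun _ : G => Bool) g).comp
      (continuous_induced_dom (f := subgroupChar (G := G)))
  have hset : {N : Subgroup G | g ∈ N} = (fun N => subgroupChar N g) ⁻¹' {true} := by
    ext N
    exact subgroupChar_eq_true.symm
  rw [hset]
  exact (isOpen_discrete _).preimage hcont

theorem FreeGroup.exists_ne_one_forall_map_mem {α G : Type*} [Nonempty α] [Group G]
    {C : Set (Subgroup G)} (hC : IsCompact C) (hnorm : ∀ N ∈ C, N.Normal)
    (φ : FreeGroup α →* G) (h : ∀ N ∈ C, ∃ w ≠ 1, φ w ∈ N) :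
    ∃ w ≠ 1, ∀ N ∈ C, φ w ∈ N := by
  suffices ∃ w ≠ 1, ∀ N ∈ C, N.Normal → φ w ∈ N by
    obtain ⟨w, hw, hwC⟩ := this
    exact ⟨w, hw, fun N hN => hwC N hN (hnorm N hN)⟩
  refine hC.induction_on (p := fun S => ∃ w ≠ 1, ∀ N ∈ S, N.Normal → φ w ∈ N) ?_ ?_ ?_ ?_
  · obtain ⟨w, hw⟩ := exists_ne (1 : FreeGroup α)
    exact ⟨w, hw, by simp⟩
  · rintro s t hst ⟨w, hw, hwt⟩
    exact ⟨w, hw, fun N hN => hwt N (hst hN)⟩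
  · rintro s t ⟨u, hu, hus⟩ ⟨v, hv, hvt⟩
    obtain ⟨w, hw, hwu, hwv⟩ := exists_ne_one_mem_normalClosure hu hv
    refine ⟨w, hw, ?_⟩
    rintro N (hN | hN) hNn
    · exact Subgroup.normalClosure_le_normal (N := N.comap φ)
        (Set.singleton_subset_iff.2 (hus N hN hNn)) hwu
    · exact Subgroup.normalClosure_le_normal (N := N.comap φ)
        (Set.singleton_subset_iff.2 (hvt N hN hNn)) hwv
  · intro N hN
    obtain ⟨w, hw, hwN⟩ := h N hN
    exact ⟨{M | φ w ∈ M}, mem_nhdsWithin_of_mem_nhds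
      ((Subgroup.isOpen_setOf_mem (φ w)).mem_nhds hwN), w, hw, fun M hM _ => hM⟩

theorem QuotGrp.exists_surjective_hom {G : Type*} [Group G] {N : Subgroup G} (h : N.Normal) :
    ∃ π : G →* QuotGrp N h, Function.Surjective π ∧ ∀ g, π g = 1 ↔ g ∈ N :=
  ⟨QuotientGroup.mk' N, QuotientGroup.mk'_surjective N, QuotientGroup.eq_one_iff⟩

/-- Let `k ≥ 1` and let `𝒞` be a closed set of normal subgroups of the free
group `F_k`.  If for every `N ∈ 𝒞` there is no injective group homomorphism from the free
group of rank 2 into `F_k ⧸ N`, then there is no injective group homomorphism from the free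
group of rank 2 into `F_k ⧸ (⋂_{N ∈ 𝒞} N)`. -/
theorem stmt_2 (k : ℕ) (hk : 1 ≤ k) (C : Set (Subgroup (FreeGroup (Fin k))))
    (hclosed : IsClosed C) (hnorm : ∀ N ∈ C, N.Normal)
    (hfree : ∀ (N : Subgroup (FreeGroup (Fin k))) (hN : N ∈ C),
      ¬ ∃ f : FreeGroup (Fin 2) →* QuotGrp N (hnorm N hN), Function.Injective f) :
    ∀ h : (sInf C).Normal,
      ¬ ∃ f : FreeGroup (Fin 2) →* QuotGrp (sInf C) h, Function.Injective f := by
  rintro h ⟨f, hf⟩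
  obtain ⟨π, hπ, hker⟩ := QuotGrp.exists_surjective_hom h
  choose a ha using fun i => hπ (f (FreeGroup.of i))
  let φ : FreeGroup (Fin 2) →* FreeGroup (Fin k) := FreeGroup.lift a
  have hφ : π.comp φ = f := FreeGroup.ext_hom _ _ fun i => by simp [φ, ha]
  have hword : ∀ N ∈ C, ∃ w ≠ 1, φ w ∈ N := by
    intro N hN
    obtain ⟨ρ, -, hρ⟩ := QuotGrp.exists_surjective_hom (hnorm N hN)
    by_contra! hcon
    refine hfree N hN ⟨ρ.comp φ, (injective_iff_map_eq_one _).2 fun w hw => ?_⟩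
    by_contra hw1
    exact hcon w hw1 ((hρ _).1 hw)
  obtain ⟨w, hw, hwC⟩ :=
    FreeGroup.exists_ne_one_forall_map_mem hclosed.isCompact hnorm φ hword
  refine hw ((injective_iff_map_eq_one f).1 hf w ?_)
  rw [← hφ]
  exact (hker _).2 (Subgroup.mem_sInf.2 hwC)
end

section
/- Let G be a weakly branch group of automorphisms of the rooted d-ary tree T_d. Then the stabilizer map ∂T_d → S(G), ξ ↦ St_G(ξ), is injective: any two distinct rays ξ ≠ η in the boundary ∂T_d have distinct stabilizer subgroups St_G(ξ) ≠ St_G(η) in G. -/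
/-- A tree automorphism of the rooted `d`-ary tree (vertices = finite words over `Fin d`):
a permutation of the vertex set preserving word length and the prefix relation in both
directions. -/
def IsTreeAut {d : ℕ} (f : Equiv.Perm (List (Fin d))) : Prop :=
  (∀ u : List (Fin d), (f u).length = u.length) ∧
    ∀ u v : List (Fin d), u <+: v ↔ f u <+: f v

/-- The length-`n` prefix of a boundary ray `ξ ∈ {0,…,d-1}^ℕ`. -/
def rayPrefix {d : ℕ} (ξ : ℕ → Fin d) (n : ℕ) : List (Fin d) :=
  List.ofFn fun i : Fin n => ξ i

/-- The stabilizer in `G` (acting on the tree via `ρ`) of the boundary ray `ξ`: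
elements fixing every finite prefix of `ξ`. -/
def rayStabilizer {d : ℕ} {G : Type*} [Group G] (ρ : G →* Equiv.Perm (List (Fin d)))
    (ξ : ℕ → Fin d) : Subgroup G where
  carrier := {g : G | ∀ n : ℕ, ρ g (rayPrefix ξ n) = rayPrefix ξ n}
  one_mem' := by intro n; simp
  mul_mem' := by
    intro a b ha hb n
    simp only [map_mul, Equiv.Perm.mul_apply, hb n, ha n]
  inv_mem' := by
    intro a ha n
    rw [map_inv]
    exact (Equiv.Perm.inv_eq_iff_eq (f := ρ a)).mpr ((ha n).symm) |>.symm ▸ rfl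

theorem length_rayPrefix {d : ℕ} (ξ : ℕ → Fin d) (n : ℕ) : (rayPrefix ξ n).length = n := by
  simp [rayPrefix]

theorem rayPrefix_prefix_rayPrefix_iff {d : ℕ} (ξ η : ℕ → Fin d) (m n : ℕ) :
    rayPrefix ξ m <+: rayPrefix η n ↔ m ≤ n ∧ ∀ i < m, ξ i = η i := by
  rw [List.prefix_iff_getElem]
  simp only [rayPrefix, List.length_ofFn, List.getElem_ofFn, exists_prop]

/-- Let `G` be a weakly branch group of automorphisms of the rooted `d`-ary
tree (a group acting faithfully by tree automorphisms, level transitively, with all rigid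
vertex stabilizers nontrivial).  Then the stabilizer map `∂T_d → S(G)`, `ξ ↦ St_G(ξ)`, is
injective: distinct rays have distinct stabilizers. -/
theorem stmt_13 {d : ℕ} {G : Type*} [Group G]
    (ρ : G →* Equiv.Perm (List (Fin d))) (hfaithful : Function.Injective ρ)
    (htree : ∀ g : G, IsTreeAut (ρ g))
    (htrans : ∀ u v : List (Fin d), u.length = v.length → ∃ g : G, ρ g u = v)
    (hrist : ∀ u : List (Fin d),
      ∃ g : G, g ≠ 1 ∧ ∀ v : List (Fin d), ¬ u <+: v → ρ g v = v) :
    Function.Injective (fun ξ : ℕ → Fin d => rayStabilizer ρ ξ) := by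
  intro ξ η hst
  by_contra hne
  obtain ⟨k, hk⟩ := Function.ne_iff.mp hne
  set u := rayPrefix η (k + 1)
  have hul : u.length = k + 1 := length_rayPrefix η (k + 1)
  have huξ (n : ℕ) : ¬ u <+: rayPrefix ξ n := fun h =>
    hk (((rayPrefix_prefix_rayPrefix_iff _ _ _ _).mp h).2 k k.lt_succ_self).symm
  obtain ⟨g, hg1, hg⟩ := hrist u
  obtain ⟨v, hv⟩ : ∃ v, ρ g v ≠ v := by
    by_contra! h
    exact hg1 (hfaithful (by ext1 v; simp [h v]))
  have huv : u <+: v := by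
    by_contra h
    exact hv (hg v h)
  obtain ⟨h, hh⟩ := htrans v (rayPrefix η v.length) (length_rayPrefix η v.length).symm
  -- `h` fixes `u`, so conjugation by `h` preserves the rigid stabilizer of `u`.
  have hhu : ρ h u = u := by
    have h₁ : ρ h u <+: rayPrefix η v.length := hh ▸ ((htree h).2 u v).mp huv
    have h₂ : u <+: rayPrefix η v.length :=
      (rayPrefix_prefix_rayPrefix_iff _ _ _ _).mpr ⟨hul ▸ huv.length_le, fun _ _ => rfl⟩
    have hlen : (ρ h u).length = u.length := (htree h).1 u
    exact (List.prefix_of_prefix_length_le h₁ h₂ hlen.le).eq_of_length hlen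
  have hmem : h * g * h⁻¹ ∈ rayStabilizer ρ ξ := fun n => by
    have hfix : ρ g ((ρ h).symm (rayPrefix ξ n)) = (ρ h).symm (rayPrefix ξ n) := by
      refine hg _ fun hp => huξ n ?_
      have hp' := ((htree h).2 _ _).mp hp
      rwa [hhu, Equiv.apply_symm_apply] at hp'
    simp only [map_mul, map_inv, Equiv.Perm.inv_def, Equiv.Perm.mul_apply, hfix,
      Equiv.apply_symm_apply]
  have hmem' : h * g * h⁻¹ ∈ rayStabilizer ρ η := by
    have hst' : rayStabilizer ρ ξ = rayStabilizer ρ η := hst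
    rwa [← hst']
  have hfixη := hmem' v.length
  rw [← hh] at hfixη
  simp only [map_mul, map_inv, Equiv.Perm.inv_def, Equiv.Perm.mul_apply,
    Equiv.symm_apply_apply] at hfixη
  exact hv ((ρ h).injective hfixη)
end

section
/- Let G be a group generated by four elements a, b, c, d satisfying a² = b² = c² = d² = 1 and b·c·d = 1. Then the commutator subgroup [G,G] of G equals the subgroup of G generated by the three elements (ab)², (ac)², (ad)². -/
open scoped commutatorElement

theorem Subgroup.mem_normalizer_closure_of_sq_eq_one {G : Type*} [Group G] {T : Set G} {g : G}
    (hg : g ^ 2 = 1) (h : ∀ t ∈ T, g * t * g⁻¹ ∈ Subgroup.closure T) :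
    g ∈ Subgroup.normalizer (Subgroup.closure T : Set G) := by
  have hle : Subgroup.closure T ≤ (Subgroup.closure T).comap (MulAut.conj g).toMonoidHom :=
    (Subgroup.closure_le _).2 fun t ht => by simpa using h t ht
  have hconj : ∀ x ∈ Subgroup.closure T, g * x * g⁻¹ ∈ Subgroup.closure T := fun x hx => by
    simpa using hle hx
  refine Subgroup.mem_normalizer_iff.2 fun x => ⟨hconj x, fun hx => ?_⟩
  have hx' : g * (g * x * g⁻¹) * g⁻¹ = x :=
    calc g * (g * x * g⁻¹) * g⁻¹ = g ^ 2 * x * (g ^ 2)⁻¹ := by simp only [pow_two, mul_inv_rev, mul_assoc]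
      _ = x := by simp [hg]
  exact hx' ▸ hconj _ hx

theorem Subgroup.normal_of_subset_normalizer {G : Type*} [Group G] {S : Set G} {H : Subgroup G}
    (hS : Subgroup.closure S = ⊤) (h : S ⊆ Subgroup.normalizer (H : Set G)) : H.Normal :=
  Subgroup.normalizer_eq_top_iff.1 (top_le_iff.1 (hS ▸ (Subgroup.closure_le _).2 h))

theorem Subgroup.commutator_le_of_closure_eq_top {G : Type*} [Group G] {S : Set G}
    {N : Subgroup G} [N.Normal] (hS : Subgroup.closure S = ⊤)
    (h : ∀ x ∈ S, ∀ y ∈ S, ⁅x, y⁆ ∈ N) : _root_.commutator G ≤ N := by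
  have hcomm : ∀ x ∈ S, ∀ y ∈ S, Commute (x : G ⧸ N) y := fun x hx y hy => by
    rw [← commutatorElement_eq_one_iff_commute]
    exact (QuotientGroup.eq_one_iff _).2 (h x hx y hy)
  have hcomm' : ∀ x y : G, Commute (x : G ⧸ N) y := fun x y => by
    have hx : x ∈ Subgroup.closure S := hS ▸ Subgroup.mem_top x
    have hy : y ∈ Subgroup.closure S := hS ▸ Subgroup.mem_top y
    induction hx, hy using Subgroup.closure_induction₂ with
    | mem x y hx hy => exact hcomm x hx y hy
    | one_left x _ => exact Commute.one_left _
    | one_right x _ => exact Commute.one_right _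
    | mul_left x y z _ _ _ h₁ h₂ => exact h₁.mul_left h₂
    | mul_right x y z _ _ _ h₁ h₂ => exact h₁.mul_right h₂
    | inv_left x y _ _ h => exact h.inv_left
    | inv_right x y _ _ h => exact h.inv_right
  rw [_root_.commutator_def, Subgroup.commutator_le]
  intro x _ y _
  exact (QuotientGroup.eq_one_iff _).1 (commutatorElement_eq_one_iff_commute.2 (hcomm' x y))

theorem commutatorElement_of_sq_eq_one {G : Type*} [Group G] {x y : G}
    (hx : x ^ 2 = 1) (hy : y ^ 2 = 1) : ⁅x, y⁆ = (x * y) ^ 2 := by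
  rw [pow_two] at hx hy
  rw [commutatorElement_def, inv_eq_of_mul_eq_one_left hx, inv_eq_of_mul_eq_one_left hy, pow_two,
    mul_assoc (x * y)]

/-- If `G` is generated by `a, b, c, d` with `a² = b² = c² = d² = 1` and
`b·c·d = 1`, then the commutator subgroup `[G,G]` equals the subgroup generated by
`(ab)², (ac)², (ad)²`. -/
theorem stmt_16 {G : Type*} [Group G] (a b c d : G)
    (hgen : Subgroup.closure {a, b, c, d} = ⊤)
    (ha : a ^ 2 = 1) (hb : b ^ 2 = 1) (hc : c ^ 2 = 1) (hd : d ^ 2 = 1)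
    (hbcd : b * c * d = 1) :
    commutator G = Subgroup.closure {(a * b) ^ 2, (a * c) ^ 2, (a * d) ^ 2} := by
  have haa : a * a = 1 := by rw [← pow_two, ha]
  have hbb : b * b = 1 := by rw [← pow_two, hb]
  have hcc : c * c = 1 := by rw [← pow_two, hc]
  have hai : a⁻¹ = a := inv_eq_of_mul_eq_one_left haa
  have hbi : b⁻¹ = b := inv_eq_of_mul_eq_one_left hbb
  have hci : c⁻¹ = c := inv_eq_of_mul_eq_one_left hcc
  have hdi : d⁻¹ = d := inv_eq_of_mul_eq_one_left (by rw [← pow_two, hd])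
  obtain rfl : d = b * c := by rw [← hdi]; exact inv_eq_of_mul_eq_one_left hbcd
  have hcb : c * b = b * c := by rw [← hdi, mul_inv_rev, hbi, hci]
  have haa' (x : G) : a * (a * x) = x := by rw [← mul_assoc, haa, one_mul]
  have hbb' (x : G) : b * (b * x) = x := by rw [← mul_assoc, hbb, one_mul]
  have hcc' (x : G) : c * (c * x) = x := by rw [← mul_assoc, hcc, one_mul]
  have hcb' (x : G) : c * (b * x) = b * (c * x) := by rw [← mul_assoc, hcb, mul_assoc]
  set T : Set G := {(a * b) ^ 2, (a * c) ^ 2, (a * (b * c)) ^ 2} with hT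
  set K := Subgroup.closure T with hK
  have h₁ : (a * b) ^ 2 ∈ K := Subgroup.subset_closure (by simp [hT])
  have h₂ : (a * c) ^ 2 ∈ K := Subgroup.subset_closure (by simp [hT])
  have h₃ : (a * (b * c)) ^ 2 ∈ K := Subgroup.subset_closure (by simp [hT])
  have conj_a {x : G} (hx : x⁻¹ = x) (h : (a * x) ^ 2 ∈ K) : a * (a * x) ^ 2 * a⁻¹ ∈ K := by
    convert K.inv_mem h using 1
    simp only [pow_two, mul_inv_rev, hai, hx, mul_assoc, haa']
  have conj_self {x : G} (hx : x⁻¹ = x) (h : (a * x) ^ 2 ∈ K) : x * (a * x) ^ 2 * x⁻¹ ∈ K := by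
    convert K.inv_mem h using 1
    simp only [pow_two, mul_inv_rev, hai, hx, mul_assoc]
    rw [mul_eq_one_iff_eq_inv.2 hx.symm, mul_one]
  have conj_of_eq {x y z : G} (hy : (a * y) ^ 2 ∈ K) (hz : (a * z) ^ 2 ∈ K)
      (h : y * (a * x) ^ 2 * y⁻¹ = ((a * y) ^ 2)⁻¹ * (a * z) ^ 2) :
      y * (a * x) ^ 2 * y⁻¹ ∈ K := h ▸ K.mul_mem (K.inv_mem hy) hz
  have hN : K.Normal := by
    refine Subgroup.normal_of_subset_normalizer hgen ?_
    rintro g (rfl | rfl | rfl | rfl) <;>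
      refine Subgroup.mem_normalizer_closure_of_sq_eq_one ‹_› ?_ <;>
      rintro t (rfl | rfl | rfl)
    · exact conj_a hbi h₁
    · exact conj_a hci h₂
    · exact conj_a hdi h₃
    · exact conj_self hbi h₁
    · refine conj_of_eq h₁ h₃ ?_
      simp only [pow_two, mul_inv_rev, mul_assoc, *]
    · refine conj_of_eq h₁ h₂ ?_
      simp only [pow_two, mul_inv_rev, mul_assoc, *]
    · refine conj_of_eq h₂ h₃ ?_
      simp only [pow_two, mul_inv_rev, mul_assoc, *]
    · exact conj_self hci h₂
    · refine conj_of_eq h₂ h₁ ?_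
      simp only [pow_two, mul_inv_rev, mul_assoc, *, mul_one]
    · refine conj_of_eq h₃ h₂ ?_
      simp only [pow_two, mul_inv_rev, mul_assoc, *]
    · refine conj_of_eq h₃ h₁ ?_
      simp only [pow_two, mul_inv_rev, mul_assoc, *, mul_one]
    · exact conj_self hdi h₃
  apply le_antisymm
  · refine Subgroup.commutator_le_of_closure_eq_top hgen ?_
    have comm_mem {x y : G} (h : Commute x y) : ⁅x, y⁆ ∈ K :=
      (commutatorElement_eq_one_iff_commute.2 h) ▸ K.one_mem
    have comm_a {x : G} (hx : x ^ 2 = 1) (h : (a * x) ^ 2 ∈ K) : ⁅a, x⁆ ∈ K :=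
      (commutatorElement_of_sq_eq_one ha hx) ▸ h
    have comm_a' {x : G} (hx : x ^ 2 = 1) (h : (a * x) ^ 2 ∈ K) : ⁅x, a⁆ ∈ K := by
      rw [← commutatorElement_inv]
      exact K.inv_mem (comm_a hx h)
    have cbc : Commute b c := hcb.symm
    rintro x (rfl | rfl | rfl | rfl) y (rfl | rfl | rfl | rfl)
    · exact comm_mem (.refl _)
    · exact comm_a hb h₁
    · exact comm_a hc h₂
    · exact comm_a hd h₃
    · exact comm_a' hb h₁
    · exact comm_mem (.refl _)
    · exact comm_mem cbc
    · exact comm_mem (.mul_right (.refl _) cbc)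
    · exact comm_a' hc h₂
    · exact comm_mem cbc.symm
    · exact comm_mem (.refl _)
    · exact comm_mem (.mul_right cbc.symm (.refl _))
    · exact comm_a' hd h₃
    · exact comm_mem (.mul_left (.refl _) cbc.symm)
    · exact comm_mem (.mul_left cbc (.refl _))
    · exact comm_mem (.refl _)
  · have mem_comm {x : G} (hx : x ^ 2 = 1) : (a * x) ^ 2 ∈ commutator G :=
      (commutatorElement_of_sq_eq_one ha hx) ▸
        Subgroup.commutator_mem_commutator (Subgroup.mem_top a) (Subgroup.mem_top x)
    refine (Subgroup.closure_le _).2 ?_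
    rintro t (rfl | rfl | rfl)
    exacts [mem_comm hb, mem_comm hc, mem_comm hd]
end

section
/- There exists a finitely generated group G of intermediate growth that has 2^{ℵ₀} pairwise non-isomorphic homomorphic images: there is a family of normal subgroups (N_x) of G indexed by a set of cardinality 2^{ℵ₀} such that for x ≠ y the quotient groups G/N_x and G/N_y are not isomorphic. -/
/-- `ball S n` is the set of elements of `G` expressible as a product of at most `n`
elements of `S ∪ S⁻¹`. -/
def ball {G : Type*} [Group G] (S : Set G) (n : ℕ) : Set G :=
  {g | ∃ l : List G, l.length ≤ n ∧ (∀ x ∈ l, x ∈ S ∨ x⁻¹ ∈ S) ∧ l.prod = g}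

/-!
A group with continuum many quotients and intermediate growth is obtained from the recursion
`b = (a, c)`, `c = (a, d)`, `d = (1, b)` of the first Grigorchuk group, where every finite level of
the binary tree is decorated with an action of a dihedral group of order 16.
-/

namespace DecoratedGrigorchuk

inductive Letter
  | a | b | c | d

open Letter

instance : Fintype Letter := ⟨⟨[a, b, c, d], by simp⟩, by rintro (_ | _) <;> simp⟩

/-- Finite binary words carrying a point of `ℤ/8` at their end. -/
abbrev Point : Type := List Bool × ZMod 8

def push (i : Bool) (x : Point) : Point := (i :: x.1, x.2)

lemma push_injective (i : Bool) : Function.Injective (push i) := by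
  rintro ⟨l, y⟩ ⟨l', y'⟩ h
  simpa [push] using h

/-- The map acting by `p` at the root, permuting the two subtrees if `e`, and acting on the
subtrees by `f false` and `f true`. -/
def node (p : ZMod 8 → ZMod 8) (e : Bool) (f : Bool → Point → Point) : Point → Point
  | ([], y) => ([], p y)
  | (i :: l, y) => push (xor i e) (f i (l, y))

lemma node_push (p : ZMod 8 → ZMod 8) (e : Bool) (f : Bool → Point → Point) (i : Bool)
    (x : Point) : node p e f (push i x) = push (xor i e) (f i x) := rfl

lemma point_cases {P : Point → Prop} (nil : ∀ y, P ([], y)) (push : ∀ i x, P (push i x))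
    (x : Point) : P x := by
  obtain ⟨_ | ⟨i, l⟩, y⟩ := x
  · exact nil y
  · exact push i (l, y)

lemma node_comp_node (p q : ZMod 8 → ZMod 8) (e e' : Bool) (f g : Bool → Point → Point) :
    node p e f ∘ node q e' g =
      node (p ∘ q) (xor e' e) (fun i => f (xor i e') ∘ g i) := by
  funext x
  induction x using point_cases with
  | nil y => rfl
  | push i x => simp [node_push]

lemma id_eq_node : (id : Point → Point) = node id false (fun _ => id) := by
  funext x
  induction x using point_cases with
  | nil y => rfl
  | push i x => simp [node_push]

def genAux : Letter → List Bool → ZMod 8 → Point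
  | a, [], y => ([], -y)
  | b, [], y => ([], y)
  | c, [], y => ([], 1 - y)
  | d, [], y => ([], 1 - y)
  | a, i :: l, y => push (!i) (l, y)
  | b, false :: l, y => push false (genAux a l y)
  | b, true :: l, y => push true (genAux c l y)
  | c, false :: l, y => push false (genAux a l y)
  | c, true :: l, y => push true (genAux d l y)
  | d, false :: l, y => push false (l, y)
  | d, true :: l, y => push true (genAux b l y)

/-- The transformation of the decorated tree given by a letter. -/
def gen (s : Letter) (x : Point) : Point := genAux s x.1 x.2

lemma gen_a : gen a = node (fun y => -y) true (fun _ => id) := by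
  funext x
  induction x using point_cases with
  | nil y => rfl
  | push i x => cases i <;> rfl

lemma gen_b : gen b = node id false (fun i => bif i then gen c else gen a) := by
  funext x
  induction x using point_cases with
  | nil y => rfl
  | push i x => cases i <;> rfl

lemma gen_c : gen c = node (fun y => 1 - y) false (fun i => bif i then gen d else gen a) := by
  funext x
  induction x using point_cases with
  | nil y => rfl
  | push i x => cases i <;> rfl

lemma gen_d : gen d = node (fun y => 1 - y) false (fun i => bif i then gen b else id) := by
  funext x
  induction x using point_cases with
  | nil y => rfl
  | push i x => cases i <;> rfl

section GenSimp

variable (y : ZMod 8) (x : Point) (i : Bool)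

@[simp] lemma gen_a_nil : gen a ([], y) = ([], -y) := rfl
@[simp] lemma gen_b_nil : gen b ([], y) = ([], y) := rfl
@[simp] lemma gen_c_nil : gen c ([], y) = ([], 1 - y) := rfl
@[simp] lemma gen_d_nil : gen d ([], y) = ([], 1 - y) := rfl
@[simp] lemma gen_a_push : gen a (push i x) = push (!i) x := rfl
@[simp] lemma gen_b_push_false : gen b (push false x) = push false (gen a x) := rfl
@[simp] lemma gen_b_push_true : gen b (push true x) = push true (gen c x) := rfl
@[simp] lemma gen_c_push_false : gen c (push false x) = push false (gen a x) := rfl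
@[simp] lemma gen_c_push_true : gen c (push true x) = push true (gen d x) := rfl
@[simp] lemma gen_d_push_false : gen d (push false x) = push false x := rfl
@[simp] lemma gen_d_push_true : gen d (push true x) = push true (gen b x) := rfl

end GenSimp

lemma point_induction {P : Point → Prop} (nil : ∀ y, P ([], y)) (push : ∀ i x, P x → P (push i x))
    (x : Point) : P x := by
  obtain ⟨l, y⟩ := x
  induction l with
  | nil => exact nil y
  | cons i l ih => exact push i (l, y) ih

@[simp] lemma gen_gen (s : Letter) (x : Point) : gen s (gen s x) = x := by
  induction x using point_induction generalizing s with
  | nil y => cases s <;> simp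
  | push i x ih => cases s <;> cases i <;> simp [ih]

lemma gen_b_gen_c (x : Point) : gen b (gen c x) = gen d x ∧ gen c (gen d x) = gen b x ∧
    gen d (gen b x) = gen c x ∧ gen c (gen b x) = gen d x ∧ gen d (gen c x) = gen b x ∧
    gen b (gen d x) = gen c x := by
  induction x using point_induction with
  | nil y => simp
  | push i x ih => cases i <;> simp [ih]

lemma length_gen (s : Letter) (x : Point) : (gen s x).1.length = x.1.length := by
  induction x using point_induction generalizing s with
  | nil y => cases s <;> simp
  | push i x ih =>
    simp only [push] at ih ⊢
    cases s <;> cases i <;> simp [gen, genAux, push] <;> exact ih _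

/-- The transformation given by a word. -/
def act : List Letter → Point → Point
  | [] => id
  | s :: w => gen s ∘ act w

@[simp] lemma act_nil : act [] = id := rfl
@[simp] lemma act_cons (s : Letter) (w : List Letter) : act (s :: w) = gen s ∘ act w := rfl

lemma act_append (v w : List Letter) : act (v ++ w) = act v ∘ act w := by
  induction v with
  | nil => rfl
  | cons s v ih => simp [ih, Function.comp_assoc]

lemma act_bijective (w : List Letter) : Function.Bijective (act w) := by
  induction w with
  | nil => exact Function.bijective_id
  | cons s w ih => exact (Function.Involutive.bijective (gen_gen s)).comp ih

/-! ### Contraction -/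

def weight : Letter → ℕ
  | a => 3
  | b => 3
  | c => 2
  | d => 1

def cost (w : List Letter) : ℕ := (w.map weight).sum

@[simp] lemma cost_nil : cost [] = 0 := rfl
@[simp] lemma cost_cons (s : Letter) (w : List Letter) : cost (s :: w) = weight s + cost w := by
  simp [cost]
lemma cost_append (v w : List Letter) : cost (v ++ w) = cost v + cost w := by
  simp [cost]

lemma one_le_weight (s : Letter) : 1 ≤ weight s := by cases s <;> decide

lemma weight_le_three (s : Letter) : weight s ≤ 3 := by cases s <;> decide

lemma cost_le (w : List Letter) : cost w ≤ 3 * w.length := by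
  induction w with
  | nil => simp
  | cons s w ih =>
    have := weight_le_three s
    simp only [cost_cons, List.length_cons]
    omega

/-- The words representing the elements of the Klein four-group generated by `b`, `c`, `d`. -/
def IsKlein (v : List Letter) : Prop := v = [] ∨ v = [b] ∨ v = [c] ∨ v = [d]

lemma IsKlein.exists_node {v : List Letter} (hv : IsKlein v) :
    ∃ (p : ZMod 8 → ZMod 8) (u : Bool → List Letter), act v = node p false (fun i => act (u i)) ∧
      6 * (cost (u false) + cost (u true)) ≤ 5 * (cost v + 3) := by
  rcases hv with rfl | rfl | rfl | rfl
  · exact ⟨id, fun _ => [], id_eq_node, by simp⟩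
  · refine ⟨id, fun i => bif i then [c] else [a], ?_, by simp [weight]⟩
    rw [act_cons, act_nil, Function.comp_id, gen_b]
    congr 1; funext i; cases i <;> rfl
  · refine ⟨fun y => 1 - y, fun i => bif i then [d] else [a], ?_, by simp [weight]⟩
    rw [act_cons, act_nil, Function.comp_id, gen_c]
    congr 1; funext i; cases i <;> rfl
  · refine ⟨fun y => 1 - y, fun i => bif i then [b] else [], ?_, by simp [weight]⟩
    rw [act_cons, act_nil, Function.comp_id, gen_d]
    congr 1; funext i; cases i <;> rfl

lemma IsKlein.exists_cons {v : List Letter} (hv : IsKlein v) {s : Letter} (hs : s ≠ a) :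
    ∃ v', IsKlein v' ∧ act v' = gen s ∘ act v ∧ cost v' ≤ weight s + cost v := by
  have key : ∀ v', IsKlein v' → (∀ x, act v' x = gen s (act v x)) →
      cost v' ≤ weight s + cost v →
      ∃ v', IsKlein v' ∧ act v' = gen s ∘ act v ∧ cost v' ≤ weight s + cost v :=
    fun v' h₁ h₂ h₃ => ⟨v', h₁, funext h₂, h₃⟩
  rcases hv with rfl | rfl | rfl | rfl <;> cases s <;> first | exact absurd rfl hs | skip
  · exact key [b] (by simp [IsKlein]) (by simp) (by simp)
  · exact key [c] (by simp [IsKlein]) (by simp) (by simp)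
  · exact key [d] (by simp [IsKlein]) (by simp) (by simp)
  · exact key [] (by simp [IsKlein]) (by simp) (by simp)
  · exact key [d] (by simp [IsKlein]) (by simp [gen_b_gen_c]) (by simp [weight])
  · exact key [c] (by simp [IsKlein]) (by simp [gen_b_gen_c]) (by simp [weight])
  · exact key [d] (by simp [IsKlein]) (by simp [gen_b_gen_c]) (by simp [weight])
  · exact key [] (by simp [IsKlein]) (by simp) (by simp)
  · exact key [b] (by simp [IsKlein]) (by simp [gen_b_gen_c]) (by simp [weight])
  · exact key [c] (by simp [IsKlein]) (by simp [gen_b_gen_c]) (by simp [weight])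
  · exact key [b] (by simp [IsKlein]) (by simp [gen_b_gen_c]) (by simp [weight])
  · exact key [] (by simp [IsKlein]) (by simp) (by simp)

lemma exists_klein_comp_node (w : List Letter) :
    ∃ (v : List Letter) (p : ZMod 8 → ZMod 8) (e : Bool) (u : Bool → List Letter),
      IsKlein v ∧ act w = act v ∘ node p e (fun i => act (u i)) ∧
      6 * (cost (u false) + cost (u true)) + 5 * cost v ≤ 5 * cost w := by
  induction w with
  | nil => exact ⟨[], id, false, fun _ => [], Or.inl rfl, id_eq_node, by simp⟩
  | cons s w ih =>
    obtain ⟨v, p, e, u, hv, hw, hc⟩ := ih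
    by_cases hs : s = a
    · subst hs
      obtain ⟨q, t, ht, htc⟩ := hv.exists_node
      refine ⟨[], (fun y => -y) ∘ q ∘ p, !e, fun i => t (xor i e) ++ u i, Or.inl rfl, ?_, ?_⟩
      · rw [act_cons, hw, ht, gen_a, node_comp_node, node_comp_node]
        simp [act_append]
      · cases e <;> simp [cost_append, weight] <;> omega
    · obtain ⟨v', hv', hact, hcost⟩ := hv.exists_cons hs
      refine ⟨v', p, e, u, hv', by rw [act_cons, hw, hact, Function.comp_assoc], ?_⟩
      rw [cost_cons]
      omega

lemma exists_node (w : List Letter) :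
    ∃ (p : ZMod 8 → ZMod 8) (e : Bool) (u : Bool → List Letter),
      act w = node p e (fun i => act (u i)) ∧
      6 * (cost (u false) + cost (u true)) ≤ 5 * (cost w + 3) := by
  obtain ⟨v, p, e, u, hv, hw, hc⟩ := exists_klein_comp_node w
  obtain ⟨q, t, ht, htc⟩ := hv.exists_node
  refine ⟨q ∘ p, e, fun i => t (xor i e) ++ u i, ?_, ?_⟩
  · rw [hw, ht, node_comp_node]
    simp [act_append]
  · cases e <;> simp [cost_append] <;> omega

/-! ### Subexponential growth -/

/-- The transformations given by words of cost at most `r`. -/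
def costBall (r : ℕ) : Set (Point → Point) := {f | ∃ w, cost w ≤ r ∧ act w = f}

lemma costBall_succ_subset (r : ℕ) : costBall (r + 1) ⊆
    (fun z : Option Letter × (Point → Point) => (z.1.elim id gen) ∘ z.2) ''
      (Set.univ ×ˢ costBall r) := by
  rintro _ ⟨_ | ⟨s, w⟩, hw, rfl⟩
  · exact ⟨(none, id), ⟨trivial, [], by simp, rfl⟩, rfl⟩
  · have := one_le_weight s
    rw [cost_cons] at hw
    exact ⟨(some s, act w), ⟨trivial, w, by omega, rfl⟩, rfl⟩

lemma costBall_zero : costBall 0 = {id} := by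
  ext f
  constructor
  · rintro ⟨_ | ⟨s, w⟩, hw, rfl⟩
    · rfl
    · have := one_le_weight s
      rw [cost_cons] at hw
      omega
  · rintro rfl
    exact ⟨[], le_rfl, rfl⟩

lemma finite_costBall (r : ℕ) : (costBall r).Finite := by
  induction r with
  | zero => simp [costBall_zero]
  | succ r ih => exact ((Set.finite_univ.prod ih).image _).subset (costBall_succ_subset r)

lemma ncard_costBall_le (r : ℕ) : (costBall r).ncard ≤ 5 ^ r := by
  induction r with
  | zero => simp [costBall_zero]
  | succ r ih =>
    have hfin : (Set.univ ×ˢ costBall r : Set (Option Letter × (Point → Point))).Finite :=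
      Set.finite_univ.prod (finite_costBall r)
    calc (costBall (r + 1)).ncard
        ≤ (Set.univ ×ˢ costBall r : Set (Option Letter × (Point → Point))).ncard :=
          (Set.ncard_le_ncard (costBall_succ_subset r) (hfin.image _)).trans
            (Set.ncard_image_le hfin)
      _ = 5 * (costBall r).ncard := by
          rw [Set.ncard_prod, Set.ncard_univ, Nat.card_eq_fintype_card]
          rfl
      _ ≤ 5 ^ (r + 1) := by rw [pow_succ]; omega

lemma costBall_subset_iUnion (r : ℕ) : costBall r ⊆
    ⋃ ij ∈ (Finset.range (r + 4) ×ˢ Finset.range (r + 4)).filter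
        (fun ij : ℕ × ℕ => 6 * (ij.1 + ij.2) ≤ 5 * (r + 3)),
      (fun z : ((ZMod 8 → ZMod 8) × Bool) × (Point → Point) × (Point → Point) =>
        node z.1.1 z.1.2 (fun i => bif i then z.2.2 else z.2.1)) ''
        (Set.univ ×ˢ (costBall ij.1 ×ˢ costBall ij.2)) := by
  rintro _ ⟨w, hw, rfl⟩
  obtain ⟨p, e, u, hact, hcost⟩ := exists_node w
  simp only [Set.mem_iUnion]
  refine ⟨(cost (u false), cost (u true)), ?_, ((p, e), act (u false), act (u true)), ?_, ?_⟩
  · simp only [Finset.mem_filter, Finset.mem_product, Finset.mem_range]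
    omega
  · exact ⟨trivial, ⟨_, le_rfl, rfl⟩, ⟨_, le_rfl, rfl⟩⟩
  · rw [hact]
    change node p e _ = node p e _
    congr 1
    funext i
    cases i <;> rfl

/-- `costBall` grows at exponential rate at most `t`. -/
def RateLE (t : ℝ) : Prop := ∃ C : ℝ, ∀ r : ℕ, ((costBall r).ncard : ℝ) ≤ C * Real.exp (t * r)

lemma ncard_costBall_le_of_bound {t C : ℝ} (ht : 0 ≤ t)
    (h : ∀ r : ℕ, ((costBall r).ncard : ℝ) ≤ C * Real.exp (t * r)) (r : ℕ) :
    ((costBall r).ncard : ℝ) ≤ (r + 4) ^ 2 *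
      (Nat.card ((ZMod 8 → ZMod 8) × Bool) * (C ^ 2 * Real.exp (t * (5 * (r + 3) / 6)))) := by
  set I := (Finset.range (r + 4) ×ˢ Finset.range (r + 4)).filter
    (fun ij : ℕ × ℕ => 6 * (ij.1 + ij.2) ≤ 5 * (r + 3)) with hI
  set φ := fun z : ((ZMod 8 → ZMod 8) × Bool) × (Point → Point) × (Point → Point) =>
    node z.1.1 z.1.2 (fun i => bif i then z.2.2 else z.2.1)
  set K := Nat.card ((ZMod 8 → ZMod 8) × Bool)
  have hfin (ij : ℕ × ℕ) : (Set.univ ×ˢ (costBall ij.1 ×ˢ costBall ij.2) :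
      Set (((ZMod 8 → ZMod 8) × Bool) × (Point → Point) × (Point → Point))).Finite :=
    Set.finite_univ.prod ((finite_costBall _).prod (finite_costBall _))
  have hC : 0 ≤ C := by
    have := (Nat.cast_nonneg _).trans (h 0)
    simpa using this
  have h₁ : (costBall r).ncard ≤ ∑ ij ∈ I, K * ((costBall ij.1).ncard * (costBall ij.2).ncard) := by
    calc (costBall r).ncard
        ≤ (⋃ ij ∈ I, φ '' (Set.univ ×ˢ (costBall ij.1 ×ˢ costBall ij.2))).ncard :=
          Set.ncard_le_ncard (costBall_subset_iUnion r)
            (I.finite_toSet.biUnion fun ij _ => (hfin ij).image _)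
      _ ≤ ∑ ij ∈ I, (φ '' (Set.univ ×ˢ (costBall ij.1 ×ˢ costBall ij.2))).ncard :=
          Finset.set_ncard_biUnion_le _ _
      _ ≤ _ := by
          refine Finset.sum_le_sum fun ij _ => (Set.ncard_image_le (hfin ij)).trans_eq ?_
          rw [Set.ncard_prod, Set.ncard_prod, Set.ncard_univ]
  have h₂ : ∀ ij ∈ I, ((K * ((costBall ij.1).ncard * (costBall ij.2).ncard) : ℕ) : ℝ) ≤
      K * (C ^ 2 * Real.exp (t * (5 * (r + 3) / 6))) := by
    intro ij hij
    have hle : (6 * (ij.1 + ij.2) : ℝ) ≤ 5 * (r + 3) := by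
      exact_mod_cast (Finset.mem_filter.1 hij).2
    push_cast
    refine mul_le_mul_of_nonneg_left ?_ (Nat.cast_nonneg _)
    calc ((costBall ij.1).ncard : ℝ) * (costBall ij.2).ncard
        ≤ (C * Real.exp (t * ij.1)) * (C * Real.exp (t * ij.2)) := by
          gcongr
          exacts [h _, h _]
      _ = C ^ 2 * Real.exp (t * (ij.1 + ij.2)) := by
          rw [mul_add, Real.exp_add]; ring
      _ ≤ _ := by
          gcongr
          linarith
  have h₃ : (I.card : ℝ) ≤ (r + 4) ^ 2 := by
    have : I.card ≤ (r + 4) * (r + 4) := by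
      simpa using Finset.card_filter_le (Finset.range (r + 4) ×ˢ Finset.range (r + 4)) _
    rw [sq]
    exact_mod_cast this
  calc ((costBall r).ncard : ℝ)
      ≤ ∑ ij ∈ I, ((K * ((costBall ij.1).ncard * (costBall ij.2).ncard) : ℕ) : ℝ) := by
        exact_mod_cast h₁
    _ ≤ I.card * (K * (C ^ 2 * Real.exp (t * (5 * (r + 3) / 6)))) := by
        simpa using Finset.sum_le_card_nsmul I _ _ h₂
    _ ≤ _ := by gcongr

lemma RateLE.contract {t : ℝ} (ht : 0 < t) (h : RateLE t) : RateLE (11 / 12 * t) := by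
  obtain ⟨C, hC⟩ := h
  set K : ℝ := (Nat.card ((ZMod 8 → ZMod 8) × Bool) : ℝ)
  refine ⟨2 * (12 / t) ^ 2 * (K * C ^ 2) * Real.exp (t * (17 / 6)), fun r => ?_⟩
  have hsq : ((r : ℝ) + 4) ^ 2 ≤ 2 * (12 / t) ^ 2 * Real.exp (t * (r + 4) / 12) := by
    have := Real.pow_div_factorial_le_exp (t * (r + 4) / 12) (by positivity) 2
    rw [div_le_iff₀ (by positivity)] at this
    calc ((r : ℝ) + 4) ^ 2 = (12 / t) ^ 2 * (t * (r + 4) / 12) ^ 2 := by field_simp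
      _ ≤ (12 / t) ^ 2 * (Real.exp (t * (r + 4) / 12) * (Nat.factorial 2 : ℕ)) := by gcongr
      _ = _ := by simp [Nat.factorial]; ring
  calc ((costBall r).ncard : ℝ)
      ≤ (r + 4) ^ 2 * (K * (C ^ 2 * Real.exp (t * (5 * (r + 3) / 6)))) :=
        ncard_costBall_le_of_bound ht.le hC r
    _ ≤ 2 * (12 / t) ^ 2 * Real.exp (t * (r + 4) / 12) *
          (K * (C ^ 2 * Real.exp (t * (5 * (r + 3) / 6)))) := by gcongr
    _ = 2 * (12 / t) ^ 2 * (K * C ^ 2) *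
          (Real.exp (t * (r + 4) / 12) * Real.exp (t * (5 * (r + 3) / 6))) := by ring
    _ = 2 * (12 / t) ^ 2 * (K * C ^ 2) *
          (Real.exp (t * (17 / 6)) * Real.exp (11 / 12 * t * r)) := by
        rw [← Real.exp_add, ← Real.exp_add]
        congr 2
        ring
    _ = _ := by ring

lemma RateLE.mono {s t : ℝ} (hst : s ≤ t) (h : RateLE s) : RateLE t := by
  obtain ⟨C, hC⟩ := h
  have hC₀ : 0 ≤ C := by
    have := (Nat.cast_nonneg _).trans (hC 0)
    simpa using this
  exact ⟨C, fun r => (hC r).trans (by gcongr)⟩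

lemma rateLE_of_pos {t : ℝ} (ht : 0 < t) : RateLE t := by
  have hlog : 0 < Real.log 5 := Real.log_pos (by norm_num)
  have h₀ : RateLE (Real.log 5) := by
    refine ⟨1, fun r => ?_⟩
    rw [mul_comm (Real.log 5), Real.exp_nat_mul, Real.exp_log (by norm_num), one_mul]
    exact_mod_cast ncard_costBall_le r
  have hk (k : ℕ) : RateLE ((11 / 12) ^ k * Real.log 5) := by
    induction k with
    | zero => simpa using h₀
    | succ k ih => rw [pow_succ', mul_assoc]; exact ih.contract (by positivity)
  obtain ⟨k, hkt⟩ := exists_pow_lt_of_lt_one (show 0 < t / Real.log 5 by positivity)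
    (show (11 / 12 : ℝ) < 1 by norm_num)
  exact (hk k).mono ((lt_div_iff₀ hlog).1 hkt).le

/-! ### The lifting substitution -/

def lift : List Letter → List Letter
  | [] => []
  | a :: w => a :: c :: a :: lift w
  | b :: w => d :: lift w
  | c :: w => b :: lift w
  | d :: w => c :: lift w

/-- The section of `lift w` at `false`; its section at `true` is `w`. -/
def shadow : List Letter → List Letter
  | [] => []
  | a :: w => d :: shadow w
  | b :: w => shadow w
  | c :: w => a :: shadow w
  | d :: w => a :: shadow w

lemma length_lift_le (w : List Letter) : (lift w).length ≤ 3 * w.length := by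
  induction w with
  | nil => simp [lift]
  | cons s w ih => cases s <;> simp [lift] <;> omega

lemma act_lift_push_false (w : List Letter) (x : Point) :
    act (lift w) (push false x) = push false (act (shadow w) x) := by
  induction w with
  | nil => rfl
  | cons s w ih => cases s <;> simp [lift, shadow, ih]

lemma act_lift_push_true (w : List Letter) (x : Point) :
    act (lift w) (push true x) = push true (act w x) := by
  induction w with
  | nil => rfl
  | cons s w ih => cases s <;> simp [lift, ih]

lemma act_shadow_lift_lift (w : List Letter) :
    act (shadow (lift (lift w))) = id ∨ act (shadow (lift (lift w))) = gen a := by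
  induction w with
  | nil => exact Or.inl rfl
  | cons s w ih =>
    rcases ih with ih | ih <;> cases s <;> simp [lift, shadow, ih, funext_iff]

lemma act_lift_lift_nil (w : List Letter) :
    (∀ y, act (lift (lift w)) ([], y) = ([], y)) ∨
      ∀ y, act (lift (lift w)) ([], y) = ([], 1 - y) := by
  induction w with
  | nil => exact Or.inl fun _ => rfl
  | cons s w ih =>
    rcases ih with ih | ih <;> cases s <;> simp [lift, ih]

/-! ### Elements supported on a single level -/

/-- The fourth power of the transformation given by `levelWord k` is supported on level `k`. -/
def levelWord : ℕ → List Letter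
  | 0 => [a, d]
  | k + 1 => lift (levelWord k)

def levelElement (k : ℕ) : Point → Point := (act (levelWord k))^[4]

lemma levelElement_succ_push_false (k : ℕ) (x : Point) :
    levelElement (k + 1) (push false x) = push false ((act (shadow (levelWord k)))^[4] x) := by
  have : Function.Semiconj (push false) (act (shadow (levelWord k))) (act (levelWord (k + 1))) :=
    fun x => (act_lift_push_false _ x).symm
  exact (this.iterate_right 4 x).symm

lemma levelElement_succ_push_true (k : ℕ) (x : Point) :
    levelElement (k + 1) (push true x) = push true (levelElement k x) := by
  have : Function.Semiconj (push true) (act (levelWord k)) (act (levelWord (k + 1))) :=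
    fun x => (act_lift_push_true _ x).symm
  exact (this.iterate_right 4 x).symm

lemma act_ad_iterate_four_push (i : Bool) (x : Point) :
    (act [a, d])^[4] (push i x) = push i x := by
  cases i <;> simp [Function.iterate_succ]

lemma act_da_iterate_four_push (i : Bool) (x : Point) :
    (act [d, a])^[4] (push i x) = push i x := by
  cases i <;> simp [Function.iterate_succ]

lemma act_dada_iterate_four (x : Point) : (act [d, a, d, a])^[4] x = x := by
  induction x using point_cases with
  | nil y => revert y; decide
  | push i x => cases i <;> simp [Function.iterate_succ]

lemma length_push (i : Bool) (x : Point) : (push i x).1.length = x.1.length + 1 := rfl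

lemma levelElement_eq_self {k : ℕ} {x : Point} (hx : x.1.length ≠ k) : levelElement k x = x := by
  induction k generalizing x with
  | zero =>
    induction x using point_cases with
    | nil y => exact absurd rfl hx
    | push i x => exact act_ad_iterate_four_push i x
  | succ k ih =>
    induction x using point_cases with
    | nil y =>
      rcases k with _ | k
      · revert y
        decide
      · rcases act_lift_lift_nil (levelWord k) with h | h <;>
          simp [levelElement, levelWord, Function.iterate_succ, h]
    | push i x =>
      rw [length_push] at hx
      cases i
      · rw [levelElement_succ_push_false]
        congr 1
        rcases k with _ | _ | k
        · induction x using point_cases with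
          | nil y => exact absurd rfl hx
          | push i x => exact act_da_iterate_four_push i x
        · exact act_dada_iterate_four x
        · rcases act_shadow_lift_lift (levelWord k) with h | h <;>
            simp [levelWord, Function.iterate_succ, h]
      · rw [levelElement_succ_push_true, ih (by omega)]

lemma exists_levelElement_ne (k : ℕ) : ∃ x : Point, x.1.length = k ∧ levelElement k x ≠ x := by
  induction k with
  | zero => exact ⟨([], 0), rfl, by decide⟩
  | succ k ih =>
    obtain ⟨x, hx, hne⟩ := ih
    refine ⟨push true x, by rw [length_push, hx], ?_⟩
    rw [levelElement_succ_push_true]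
    exact fun h => hne (push_injective _ h)

lemma levelElement_injective : Function.Injective levelElement := by
  intro j k h
  obtain ⟨x, hx, hne⟩ := exists_levelElement_ne j
  by_contra hjk
  exact hne (h ▸ levelElement_eq_self (hx.trans_ne hjk))

/-! ### Superpolynomial growth -/

/-- The transformations given by words of length at most `n`. -/
def wordBall (n : ℕ) : Set (Point → Point) := {f | ∃ w, w.length ≤ n ∧ act w = f}

lemma wordBall_subset_costBall (n : ℕ) : wordBall n ⊆ costBall (3 * n) := by
  rintro _ ⟨w, hw, rfl⟩
  exact ⟨w, (cost_le w).trans (by omega), rfl⟩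

lemma finite_wordBall (n : ℕ) : (wordBall n).Finite :=
  (finite_costBall _).subset (wordBall_subset_costBall n)

lemma wordBall_mono {m n : ℕ} (h : m ≤ n) : wordBall m ⊆ wordBall n := by
  rintro _ ⟨w, hw, rfl⟩
  exact ⟨w, hw.trans h, rfl⟩

lemma levelElement_mem_range_act (k : ℕ) : levelElement k ∈ Set.range act := by
  refine ⟨levelWord k ++ (levelWord k ++ (levelWord k ++ levelWord k)), ?_⟩
  simp only [act_append]
  rfl

lemma exists_lt_ncard_wordBall (C : ℕ) : ∃ n, 1 ≤ n ∧ C < (wordBall n).ncard := by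
  choose w hw using levelElement_mem_range_act
  refine ⟨(∑ k ∈ Finset.range (C + 1), (w k).length) + 1, by omega, ?_⟩
  have hsub : levelElement '' (Finset.range (C + 1) : Set ℕ) ⊆
      wordBall ((∑ k ∈ Finset.range (C + 1), (w k).length) + 1) := by
    rintro _ ⟨k, hk, rfl⟩
    have := Finset.single_le_sum (f := fun k => (w k).length) (fun _ _ => Nat.zero_le _) hk
    exact ⟨w k, Nat.le_succ_of_le this, hw k⟩
  have := Set.ncard_le_ncard hsub (finite_wordBall _)
  rw [Set.ncard_image_of_injective _ levelElement_injective, Set.ncard_coe_finset,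
    Finset.card_range] at this
  omega

lemma shadow_exists_node (w : List Letter) : ∃ (p : ZMod 8 → ZMod 8) (e : Bool) (q : Bool → Bool),
    act (shadow w) = node p e (fun i => bif q i then gen b else id) := by
  have key (p : ZMod 8 → ZMod 8) (e : Bool) (q : Bool → Bool) (s : Letter) (hs : s = a ∨ s = d) :
      ∃ (p' : ZMod 8 → ZMod 8) (e' : Bool) (q' : Bool → Bool),
        gen s ∘ node p e (fun i => bif q i then gen b else id) =
          node p' e' (fun i => bif q' i then gen b else id) := by
    rcases hs with rfl | rfl
    · rw [gen_a, node_comp_node]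
      exact ⟨_, _, q, rfl⟩
    · rw [gen_d, node_comp_node]
      refine ⟨(fun y => 1 - y) ∘ p, e, fun i => xor (xor i e) (q i), ?_⟩
      simp only [Bool.xor_false]
      congr 1
      funext i x
      cases xor i e <;> cases q i <;> simp
  induction w with
  | nil => exact ⟨_, _, fun _ => false, id_eq_node⟩
  | cons s w ih =>
    obtain ⟨p, e, q, h⟩ := ih
    cases s
    · rw [shadow, act_cons, h]
      exact key p e q d (Or.inr rfl)
    · exact ⟨p, e, q, h⟩
    · rw [shadow, act_cons, h]
      exact key p e q a (Or.inl rfl)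
    · rw [shadow, act_cons, h]
      exact key p e q a (Or.inl rfl)

def shadows : Set (Point → Point) := Set.range fun w => act (shadow w)

lemma finite_shadows : shadows.Finite := by
  refine (Set.finite_range fun z : (ZMod 8 → ZMod 8) × Bool × (Bool → Bool) =>
    node z.1 z.2.1 (fun i => bif z.2.2 i then gen b else id)).subset ?_
  rintro _ ⟨w, rfl⟩
  obtain ⟨p, e, q, h⟩ := shadow_exists_node w
  exact ⟨(p, e, q), h.symm⟩

lemma ncard_wordBall_sq_le (n : ℕ) :
    (wordBall n).ncard ^ 2 ≤ (wordBall (6 * n + 2)).ncard * shadows.ncard ^ 2 := by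
  have hword : ∀ f : Point → Point, ∃ w, f ∈ wordBall n → w.length ≤ n ∧ act w = f := by
    intro f
    by_cases hf : f ∈ wordBall n
    · obtain ⟨w, hw⟩ := hf
      exact ⟨w, fun _ => hw⟩
    · exact ⟨[], fun h => absurd h hf⟩
  choose w hw using hword
  let φ (z : (Point → Point) × (Point → Point)) :
      (Point → Point) × (Point → Point) × (Point → Point) :=
    (act (a :: (lift (w z.1) ++ a :: lift (w z.2))), act (shadow (w z.1)), act (shadow (w z.2)))
  have hmaps : Set.MapsTo φ (wordBall n ×ˢ wordBall n)
      (wordBall (6 * n + 2) ×ˢ (shadows ×ˢ shadows)) := by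
    rintro ⟨f, g⟩ ⟨hf, hg⟩
    refine ⟨⟨_, ?_, rfl⟩, ⟨_, rfl⟩, ⟨_, rfl⟩⟩
    have h₁ := length_lift_le (w f)
    have h₂ := length_lift_le (w g)
    have h₃ := (hw f hf).1
    have h₄ := (hw g hg).1
    simp only [List.length_cons, List.length_append]
    omega
  have hinj : Set.InjOn φ (wordBall n ×ˢ wordBall n) := by
    rintro ⟨f, g⟩ ⟨hf, hg⟩ ⟨f', g'⟩ ⟨hf', hg'⟩ h
    simp only [φ, Prod.mk.injEq] at h
    obtain ⟨h, h₁, h₂⟩ := h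
    have key : f = f' := by
      funext x
      obtain ⟨y, rfl⟩ := (act_bijective (shadow (w g))).2 x
      have := congrFun h (push false y)
      simp only [act_cons, act_append, Function.comp_apply, act_lift_push_false, gen_a_push,
        Bool.not_false, act_lift_push_true, Bool.not_true, (hw f hf).2, (hw f' hf').2] at this
      rw [push_injective _ this, h₂]
    have key' : g = g' := by
      funext x
      have := congrFun h (push true x)
      simp only [act_cons, act_append, Function.comp_apply, act_lift_push_false, gen_a_push,
        Bool.not_false, act_lift_push_true, Bool.not_true, (hw g hg).2, (hw g' hg').2] at this
      rw [← h₁] at this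
      exact (act_bijective _).1 (push_injective _ this)
    rw [key, key']
  have hfin : (wordBall (6 * n + 2) ×ˢ (shadows ×ˢ shadows)).Finite :=
    (finite_wordBall _).prod (finite_shadows.prod finite_shadows)
  have := Set.ncard_le_ncard_of_injOn φ hmaps hinj hfin
  rwa [Set.ncard_prod, Set.ncard_prod, Set.ncard_prod, ← sq, ← sq] at this

lemma exists_pow_lt_ncard_wordBall (r : ℕ) : ∃ n : ℕ, n ^ r < (wordBall n).ncard := by
  by_contra! hpoly
  set M := shadows.ncard ^ 2
  have hM : 0 < M := by
    have : 0 < shadows.ncard := (Set.ncard_pos finite_shadows).2 ⟨_, [], rfl⟩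
    positivity
  obtain ⟨m, hm, hlt⟩ := exists_lt_ncard_wordBall (M * 2)
  have hgrow (k : ℕ) : M * 2 ^ 2 ^ k ≤ (wordBall (8 ^ k * m)).ncard := by
    induction k with
    | zero => simpa using hlt.le
    | succ k ih =>
      have hpos : 1 ≤ 8 ^ k * m := Nat.mul_pos (by positivity) hm
      have h₁ := ncard_wordBall_sq_le (8 ^ k * m)
      have h₂ : (wordBall (6 * (8 ^ k * m) + 2)).ncard ≤ (wordBall (8 ^ (k + 1) * m)).ncard :=
        Set.ncard_le_ncard (wordBall_mono (by rw [pow_succ]; linarith)) (finite_wordBall _)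
      refine Nat.le_of_mul_le_mul_right ?_ hM
      calc M * 2 ^ 2 ^ (k + 1) * M = (M * 2 ^ 2 ^ k) ^ 2 := by ring
        _ ≤ (wordBall (8 ^ k * m)).ncard ^ 2 := by gcongr
        _ ≤ _ := h₁.trans (by gcongr)
  have hexp (k : ℕ) : 2 ^ k ≤ (3 * k + m) * r := by
    refine (Nat.pow_le_pow_iff_right (le_refl 2)).1 ?_
    calc 2 ^ 2 ^ k ≤ M * 2 ^ 2 ^ k := Nat.le_mul_of_pos_left _ hM
      _ ≤ (8 ^ k * m) ^ r := (hgrow k).trans (hpoly _)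
      _ ≤ (8 ^ k * 2 ^ m) ^ r := by gcongr; exact Nat.lt_two_pow_self.le
      _ = 2 ^ ((3 * k + m) * r) := by
          rw [pow_mul, pow_add, pow_mul]
          norm_num
  have hlin := tendsto_pow_const_div_const_pow_of_one_lt 1 (show (1 : ℝ) < 2 by norm_num)
  have hconst := tendsto_pow_const_div_const_pow_of_one_lt 0 (show (1 : ℝ) < 2 by norm_num)
  have hsum := (hlin.const_mul (3 * r : ℝ)).add (hconst.const_mul (m * r : ℝ))
  rw [mul_zero, mul_zero, add_zero] at hsum
  obtain ⟨k, hk⟩ := (hsum.eventually_lt_const one_pos).exists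
  have h2 : (0 : ℝ) < 2 ^ k := by positivity
  rw [← mul_div_assoc, ← mul_div_assoc, ← add_div, div_lt_one h2] at hk
  have : (2 : ℝ) ^ k ≤ (3 * k + m) * r := by exact_mod_cast hexp k
  simp only [pow_one, pow_zero] at hk
  linarith

/-! ### The group -/

def genPerm (s : Letter) : Equiv.Perm Point := Function.Involutive.toPerm (gen s) (gen_gen s)

abbrev DecoratedGroup : Type := Subgroup.closure (Set.range genPerm)

def generators : Set DecoratedGroup := Subtype.val ⁻¹' Set.range genPerm

lemma finite_generators : generators.Finite :=
  (Set.finite_range genPerm).preimage Subtype.val_injective.injOn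

lemma closure_generators : Subgroup.closure generators = ⊤ :=
  Subgroup.closure_closure_coe_preimage

lemma genPerm_inv (s : Letter) : (genPerm s)⁻¹ = genPerm s := rfl

lemma exists_word {l : List DecoratedGroup} (hl : ∀ x ∈ l, x ∈ generators ∨ x⁻¹ ∈ generators) :
    ∃ w : List Letter, w.length = l.length ∧ act w = (l.prod : Equiv.Perm Point) := by
  induction l with
  | nil => exact ⟨[], rfl, rfl⟩
  | cons x l ih =>
    obtain ⟨w, hlen, hw⟩ := ih fun y hy => hl y (List.mem_cons_of_mem _ hy)
    obtain ⟨s, hs⟩ : ∃ s, genPerm s = x := by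
      rcases hl x List.mem_cons_self with h | ⟨s, hs⟩
      · exact h
      · refine ⟨s, ?_⟩
        rw [← genPerm_inv, hs]
        rfl
    refine ⟨s :: w, by simp [hlen], ?_⟩
    rw [act_cons, hw, List.prod_cons, Subgroup.coe_mul, ← hs]
    rfl

def letterElement (s : Letter) : DecoratedGroup :=
  ⟨genPerm s, Subgroup.subset_closure ⟨s, rfl⟩⟩

def wordElement (w : List Letter) : DecoratedGroup := (w.map letterElement).prod

lemma coe_wordElement (w : List Letter) : ⇑(wordElement w : Equiv.Perm Point) = act w := by
  induction w with
  | nil => rfl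
  | cons s w ih =>
    rw [act_cons, ← ih]
    rfl

lemma natCard_ball (n : ℕ) : Nat.card (ball generators n) = (wordBall n).ncard := by
  have himage : (fun g : DecoratedGroup => ⇑(g : Equiv.Perm Point)) '' ball generators n =
      wordBall n := by
    ext f
    constructor
    · rintro ⟨_, ⟨l, hlen, hl, rfl⟩, rfl⟩
      obtain ⟨w, hw, hact⟩ := exists_word hl
      exact ⟨w, hw.trans_le hlen, hact⟩
    · rintro ⟨w, hw, rfl⟩
      refine ⟨wordElement w, ⟨w.map letterElement, by simpa using hw, ?_, rfl⟩, coe_wordElement w⟩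
      intro x hx
      obtain ⟨s, -, rfl⟩ := List.mem_map.1 hx
      exact Or.inl ⟨s, rfl⟩
  rw [← himage, Set.ncard_image_of_injective, Nat.card_coe_set_eq]
  exact DFunLike.coe_injective.comp Subtype.val_injective

lemma tendsto_natCard_ball_rpow : Filter.Tendsto
    (fun n : ℕ => (Nat.card (ball generators n) : ℝ) ^ ((n : ℝ)⁻¹)) Filter.atTop (nhds 1) := by
  have hone (n : ℕ) : (1 : ℝ) ≤ Nat.card (ball generators n) := by
    rw [natCard_ball]
    exact_mod_cast (Set.ncard_pos (finite_wordBall n)).2 ⟨id, [], by simp, rfl⟩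
  refine tendsto_order.2 ⟨fun u hu => Filter.Eventually.of_forall fun n =>
    hu.trans_le (Real.one_le_rpow (hone n) (by positivity)), fun u hu => ?_⟩
  have hlog : 0 < Real.log u := Real.log_pos hu
  obtain ⟨C, hC⟩ := rateLE_of_pos (show 0 < Real.log u / 6 by positivity)
  have hle (n : ℕ) : (Nat.card (ball generators n) : ℝ) ≤ C * Real.exp (Real.log u / 2 * n) := by
    rw [natCard_ball]
    calc ((wordBall n).ncard : ℝ) ≤ (costBall (3 * n)).ncard := by
          exact_mod_cast Set.ncard_le_ncard (wordBall_subset_costBall n) (finite_costBall _)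
      _ ≤ C * Real.exp (Real.log u / 6 * (3 * n : ℕ)) := hC _
      _ = _ := by push_cast; ring_nf
  have hC₀ : 0 < C := by
    have := (hone 0).trans (hle 0)
    simp at this
    linarith
  have hlim : Filter.Tendsto (fun n : ℕ => C ^ ((n : ℝ)⁻¹) * Real.exp (Real.log u / 2))
      Filter.atTop (nhds (Real.exp (Real.log u / 2))) := by
    have := (Real.continuousAt_const_rpow hC₀.ne').tendsto.comp
      (tendsto_inv_atTop_nhds_zero_nat (𝕜 := ℝ))
    simpa using this.mul_const (Real.exp (Real.log u / 2))
  have hlt : Real.exp (Real.log u / 2) < u := by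
    rw [← Real.lt_log_iff_exp_lt (by linarith)]
    linarith
  filter_upwards [hlim.eventually_lt_const hlt, Filter.eventually_gt_atTop 0] with n hn hpos
  refine lt_of_le_of_lt ?_ hn
  calc (Nat.card (ball generators n) : ℝ) ^ ((n : ℝ)⁻¹)
      ≤ (C * Real.exp (Real.log u / 2 * n)) ^ ((n : ℝ)⁻¹) :=
        Real.rpow_le_rpow (by positivity) (hle n) (by positivity)
    _ = C ^ ((n : ℝ)⁻¹) * Real.exp (Real.log u / 2) := by
        rw [Real.mul_rpow hC₀.le (Real.exp_pos _).le, ← Real.exp_mul, mul_assoc,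
          mul_inv_cancel₀ (by positivity), mul_one]

/-! ### Normal subgroups -/

lemma length_apply (g : DecoratedGroup) (x : Point) :
    ((g : Equiv.Perm Point) x).1.length = x.1.length := by
  obtain ⟨g, hg⟩ := g
  induction hg using Subgroup.closure_induction generalizing x with
  | mem g hg =>
    obtain ⟨s, rfl⟩ := hg
    exact length_gen s x
  | one => rfl
  | mul g h _ _ ihg ihh => exact (ihg _).trans (ihh x)
  | inv g _ ih => simpa using (ih (g⁻¹ x)).symm

/-- The subgroup of elements acting trivially on all levels in `A`. -/
def levelFixer (A : ℕ → Bool) : Subgroup DecoratedGroup where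
  carrier := {g | ∀ x : Point, A x.1.length = true → (g : Equiv.Perm Point) x = x}
  one_mem' := fun _ _ => rfl
  mul_mem' := by
    intro g h hg hh x hx
    rw [Subgroup.coe_mul, Equiv.Perm.mul_apply, hh x hx, hg x hx]
  inv_mem' := by
    intro g hg x hx
    rw [Subgroup.coe_inv, Equiv.Perm.inv_eq_iff_eq, hg x hx]

lemma levelFixer_normal (A : ℕ → Bool) : (levelFixer A).Normal where
  conj_mem := by
    intro n hn g x hx
    change (g : Equiv.Perm Point) ((n : Equiv.Perm Point) ((g⁻¹ : DecoratedGroup).1 x)) = x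
    rw [hn _ (by rwa [length_apply])]
    exact (g : Equiv.Perm Point).apply_symm_apply x

lemma levelFixer_injective : Function.Injective levelFixer := by
  intro A B h
  funext k
  obtain ⟨w, hw⟩ := levelElement_mem_range_act k
  have key (A : ℕ → Bool) : wordElement w ∈ levelFixer A ↔ A k = false := by
    change (∀ x : Point, A x.1.length = true → (wordElement w : Equiv.Perm Point) x = x) ↔ _
    rw [coe_wordElement, hw]
    constructor
    · intro hA
      obtain ⟨x, hx, hne⟩ := exists_levelElement_ne k
      exact Bool.eq_false_iff.2 fun hk => hne (hA x (hx ▸ hk))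
    · intro hA x hx
      refine levelElement_eq_self ?_
      rintro rfl
      simp [hA] at hx
  have := key A
  rw [h, key B] at this
  cases hA : A k <;> cases hB : B k <;> simp_all

end DecoratedGrigorchuk

/-! ### Isomorphism classes of quotients of finitely generated groups -/

lemma countable_of_closure_eq_top {G : Type*} [Group G] {S : Set G} (hS : S.Finite)
    (hgen : Subgroup.closure S = ⊤) : Countable G := by
  have := hS.to_subtype
  refine Function.Surjective.countable (f := FreeGroup.lift ((↑) : S → G)) ?_
  rw [← MonoidHom.range_eq_top, FreeGroup.range_lift_eq_closure, Subtype.range_coe, hgen]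

lemma countable_monoidHom {G Q : Type*} [Group G] [Group Q] [Countable Q] {S : Set G}
    (hS : S.Finite) (hgen : Subgroup.closure S = ⊤) : Countable (G →* Q) := by
  have := hS.to_subtype
  refine Function.Injective.countable (f := fun (φ : G →* Q) (s : S) => φ s) fun φ ψ h => ?_
  exact MonoidHom.eq_of_eqOn_dense hgen fun s hs => congrFun h ⟨s, hs⟩

/-- A finitely generated group with continuum many normal subgroups has continuum many pairwise
non-isomorphic quotients. -/
lemma exists_pairwise_nonisomorphic_quotients {G : Type*} [Group G] {S : Set G} (hS : S.Finite)
    (hgen : Subgroup.closure S = ⊤) {N : (ℕ → Bool) → Subgroup G} (hN : ∀ x, (N x).Normal)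
    (hinj : Function.Injective N) :
    ∃ f : (ℕ → Bool) → (ℕ → Bool), ∀ x y, x ≠ y →
      IsEmpty (QuotGrp (N (f x)) (hN (f x)) ≃* QuotGrp (N (f y)) (hN (f y))) := by
  have hG : Countable G := countable_of_closure_eq_top hS hgen
  let r : Setoid (ℕ → Bool) :=
    { r := fun x y => Nonempty (QuotGrp (N x) (hN x) ≃* QuotGrp (N y) (hN y))
      iseqv := ⟨fun _ => ⟨MulEquiv.refl _⟩, fun ⟨e⟩ => ⟨e.symm⟩, fun ⟨e⟩ ⟨e'⟩ => ⟨e.trans e'⟩⟩ }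
  let π (x : ℕ → Bool) : G →* QuotGrp (N x) (hN x) := @QuotientGroup.mk' G _ (N x) (hN x)
  have hker (x) : (π x).ker = N x := @QuotientGroup.ker_mk' G _ (N x) (hN x)
  have hsurj (x) : Function.Surjective (π x) := @QuotientGroup.mk'_surjective G _ (N x) (hN x)
  have hclass (q : Quotient r) : Countable (Quotient.mk r ⁻¹' {q}) := by
    have : Countable (QuotGrp (N q.out) (hN q.out)) := (hsurj q.out).countable
    have := countable_monoidHom (Q := QuotGrp (N q.out) (hN q.out)) hS hgen
    have he (y : Quotient.mk r ⁻¹' {q}) :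
        Nonempty (QuotGrp (N y) (hN y) ≃* QuotGrp (N q.out) (hN q.out)) :=
      Quotient.exact (s := r) (y.2.trans q.out_eq.symm)
    refine Function.Injective.countable
      (f := fun y => ((he y).some : _ →* QuotGrp (N q.out) (hN q.out)).comp (π y)) ?_
    intro y z h
    have hk (y : Quotient.mk r ⁻¹' {q}) :
        (((he y).some : _ →* QuotGrp (N q.out) (hN q.out)).comp (π y)).ker = N y := by
      refine Eq.trans ?_ (hker y)
      ext g
      simp [MonoidHom.mem_ker]
    refine Subtype.ext (hinj ?_)
    rw [← hk y, ← hk z]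
    exact congrArg MonoidHom.ker h
  have hcard : Cardinal.mk (Quotient r) = Cardinal.mk (ℕ → Bool) := by
    refine le_antisymm Cardinal.mk_quotient_le ?_
    by_contra! hlt
    choose ν hν using fun q => (hclass q).exists_injective_nat
    have hle : Cardinal.mk (ℕ → Bool) ≤ Cardinal.mk (Quotient r × ℕ) := by
      refine Cardinal.mk_le_of_injective
        (f := fun x => (Quotient.mk r x, ν (Quotient.mk r x) ⟨x, rfl⟩)) fun x y h => ?_
      simp only [Prod.mk.injEq] at h
      obtain ⟨h, h'⟩ := h
      have transport : ∀ q (hq : Quotient.mk r y = q),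
          ν q ⟨y, hq⟩ = ν (Quotient.mk r y) ⟨y, rfl⟩ := by
        rintro _ rfl
        rfl
      rw [← transport _ h.symm] at h'
      exact congrArg Subtype.val (hν _ h')
    have hcont : Cardinal.aleph0 < Cardinal.mk (ℕ → Bool) := by
      simpa using Cardinal.cantor Cardinal.aleph0
    refine hle.not_gt ?_
    simpa using Cardinal.mul_lt_of_lt hcont.le hlt hcont
  obtain ⟨e⟩ := Cardinal.eq.1 hcard
  refine ⟨fun x => (e.symm x).out, fun x y hxy => ⟨fun i => hxy ?_⟩⟩
  have : (⟦(e.symm x).out⟧ : Quotient r) = ⟦(e.symm y).out⟧ := Quotient.sound ⟨i⟩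
  rwa [Quotient.out_eq, Quotient.out_eq, e.symm.injective.eq_iff] at this

/-- There exists a finitely generated group `G` of intermediate growth
(superpolynomial: for every `d` there is `n` with `γ(n) > n^d`; subexponential:
`γ(n)^{1/n} → 1`) together with a family of normal subgroups indexed by a set of
cardinality `2^{ℵ₀}` (here `ℕ → Bool`) whose quotients are pairwise non-isomorphic. -/
theorem stmt_18 :
    ∃ (G : Type) (_ : Group G) (S : Set G) (N : (ℕ → Bool) → Subgroup G)
      (hN : ∀ x : ℕ → Bool, (N x).Normal),
      S.Finite ∧ Subgroup.closure S = ⊤ ∧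
      (∀ d : ℕ, ∃ n : ℕ, n ^ d < Nat.card (ball S n)) ∧
      Filter.Tendsto (fun n : ℕ => (Nat.card (ball S n) : ℝ) ^ ((n : ℝ)⁻¹))
        Filter.atTop (nhds 1) ∧
      (∀ x y : ℕ → Bool, x ≠ y →
        IsEmpty (QuotGrp (N x) (hN x) ≃* QuotGrp (N y) (hN y))) := by
  obtain ⟨f, hf⟩ := exists_pairwise_nonisomorphic_quotients
    DecoratedGrigorchuk.finite_generators DecoratedGrigorchuk.closure_generators
    DecoratedGrigorchuk.levelFixer_normal DecoratedGrigorchuk.levelFixer_injective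
  refine ⟨DecoratedGrigorchuk.DecoratedGroup, inferInstance, DecoratedGrigorchuk.generators,
    fun x => DecoratedGrigorchuk.levelFixer (f x),
    fun x => DecoratedGrigorchuk.levelFixer_normal (f x),
    DecoratedGrigorchuk.finite_generators, DecoratedGrigorchuk.closure_generators, fun d => ?_,
    DecoratedGrigorchuk.tendsto_natCard_ball_rpow, hf⟩
  simpa only [DecoratedGrigorchuk.natCard_ball] using
    DecoratedGrigorchuk.exists_pow_lt_ncard_wordBall d
end

section
/- There exists a finitely generated group G of intermediate growth such that the set of continuous ergodic invariant random subgroups of G — that is, atomless, ergodic, conjugation-invariant Borel probability measures on the space S(G) of subgroups of G — has cardinality 2^{ℵ₀}. -/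
open MeasureTheory

/-- The Borel σ-algebra on the space of subgroups. -/
noncomputable instance {G : Type*} [Group G] : MeasurableSpace (Subgroup G) :=
  borel (Subgroup G)

/-- The conjugate subgroup `N^x = x⁻¹ N x`. -/
def conjSubgroup {G : Type*} [Group G] (x : G) (N : Subgroup G) : Subgroup G :=
  N.map (MulAut.conj x⁻¹).toMonoidHom

open Equiv (Perm)

/-! ### The Grigorchuk group acting on binary sequences -/

namespace Grigorchuk

/-- Prepend a bit to a binary sequence. -/
def cons (b : Bool) (x : ℕ → Bool) : ℕ → Bool
  | 0 => b
  | n + 1 => x n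

/-- Remove the first bit of a binary sequence. -/
def tail (x : ℕ → Bool) : ℕ → Bool := fun n => x (n + 1)

@[simp] lemma cons_zero (b : Bool) (x : ℕ → Bool) : cons b x 0 = b := rfl

@[simp] lemma cons_succ (b : Bool) (x : ℕ → Bool) (n : ℕ) : cons b x (n + 1) = x n := rfl

@[simp] lemma tail_apply (x : ℕ → Bool) (n : ℕ) : tail x n = x (n + 1) := rfl

@[simp] lemma tail_cons (b : Bool) (x : ℕ → Bool) : tail (cons b x) = x := rfl

@[simp] lemma cons_tail (x : ℕ → Bool) : cons (x 0) (tail x) = x := by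
  funext n; cases n <;> rfl

lemma cons_tail_of_eq {x : ℕ → Bool} {b : Bool} (h : x 0 = b) : cons b (tail x) = x := by
  subst h; simp

/-- The permutation acting by `f` on sequences starting with `false` and by `g` on sequences
starting with `true`. -/
def pair (f g : Perm (ℕ → Bool)) : Perm (ℕ → Bool) where
  toFun x := cons (x 0) (if x 0 then g (tail x) else f (tail x))
  invFun x := cons (x 0) (if x 0 then g⁻¹ (tail x) else f⁻¹ (tail x))
  left_inv x := by
    by_cases h : x 0 <;> simp [h, cons_tail_of_eq]
  right_inv x := by
    by_cases h : x 0 <;> simp [h, cons_tail_of_eq]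

lemma pair_apply (f g : Perm (ℕ → Bool)) (x : ℕ → Bool) :
    pair f g x = cons (x 0) (if x 0 then g (tail x) else f (tail x)) := rfl

lemma pair_mul (f g f' g' : Perm (ℕ → Bool)) :
    pair f g * pair f' g' = pair (f * f') (g * g') := by
  ext1 x
  by_cases h : x 0 <;> simp [pair_apply, h]

@[simp] lemma pair_one : pair 1 1 = 1 := by
  ext1 x
  simp [pair_apply]

lemma pair_inv (f g : Perm (ℕ → Bool)) : (pair f g)⁻¹ = pair f⁻¹ g⁻¹ := by
  rw [inv_eq_iff_mul_eq_one, pair_mul]; simp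

lemma pair_injective {f g f' g' : Perm (ℕ → Bool)} (h : pair f g = pair f' g') :
    f = f' ∧ g = g' := by
  constructor
  · ext1 x
    have := congrArg tail (Equiv.congr_fun h (cons false x))
    simpa [pair_apply] using this
  · ext1 x
    have := congrArg tail (Equiv.congr_fun h (cons true x))
    simpa [pair_apply] using this

/-- The generator `a`, flipping the first bit. -/
def flip : Perm (ℕ → Bool) where
  toFun x := cons (!x 0) (tail x)
  invFun x := cons (!x 0) (tail x)
  left_inv x := by simp
  right_inv x := by simp

lemma flip_apply (x : ℕ → Bool) : flip x = cons (!x 0) (tail x) := rfl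

@[simp] lemma flip_mul_flip : flip * flip = 1 := by
  ext1 x; simp [flip_apply]

@[simp] lemma flip_inv : flip⁻¹ = flip := by
  rw [inv_eq_iff_mul_eq_one]; simp

lemma flip_mul_pair (f g : Perm (ℕ → Bool)) : flip * pair f g = pair g f * flip := by
  ext1 x
  by_cases h : x 0 <;> simp [pair_apply, flip_apply, h]

/-- `flip` or the identity. -/
def flipIf (p : Bool) : Perm (ℕ → Bool) := if p then flip else 1

@[simp] lemma flipIf_true : flipIf true = flip := rfl

@[simp] lemma flipIf_false : flipIf false = 1 := rfl

lemma flipIf_mul (p q : Bool) : flipIf p * flipIf q = flipIf (p ^^ q) := by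
  cases p <;> cases q <;> simp

/-- The cyclic permutation `b ↦ c ↦ d ↦ b` of the Klein four group `Bool × Bool`, where
`b = (true, true)`, `c = (true, false)` and `d = (false, true)`. -/
def next (u : Bool × Bool) : Bool × Bool := (u.2, u.1 ^^ u.2)

/-- The group law of the Klein four group `Bool × Bool`. -/
def kleinAdd (u v : Bool × Bool) : Bool × Bool := (u.1 ^^ v.1, u.2 ^^ v.2)

/-- The action of the Klein four group `{1, b, c, d}` on binary sequences. -/
def kleinFun : Bool × Bool → (ℕ → Bool) → ℕ → Bool
  | _, x, 0 => x 0
  | u, x, n + 1 => if x 0 then kleinFun (next u) (tail x) n else flipIf u.1 (tail x) n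

lemma kleinFun_eq (u : Bool × Bool) (x : ℕ → Bool) :
    kleinFun u x = cons (x 0) (if x 0 then kleinFun (next u) (tail x) else flipIf u.1 (tail x)) := by
  funext n
  cases n with
  | zero => rfl
  | succ n => by_cases h : x 0 <;> simp [kleinFun, h]

lemma kleinFun_add (u v : Bool × Bool) (x : ℕ → Bool) (n : ℕ) :
    kleinFun u (kleinFun v x) n = kleinFun (kleinAdd u v) x n := by
  induction n generalizing u v x with
  | zero => rfl
  | succ n ih =>
    have h1 : next (kleinAdd u v) = kleinAdd (next u) (next v) := by
      rcases u with ⟨_ | _, _ | _⟩ <;> rcases v with ⟨_ | _, _ | _⟩ <;> rfl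
    rw [kleinFun_eq v x]
    by_cases h : x 0
    · simp [kleinFun, h, ih, h1]
    · have : flipIf u.1 (flipIf v.1 (tail x)) = flipIf (kleinAdd u v).1 (tail x) := by
        rw [← Equiv.Perm.mul_apply, flipIf_mul]; rfl
      simp [kleinFun, h, this]

lemma kleinFun_zero (x : ℕ → Bool) (n : ℕ) : kleinFun (false, false) x n = x n := by
  induction n generalizing x with
  | zero => rfl
  | succ n ih =>
    by_cases h : x 0
    · simp [kleinFun, h, next, ih]
    · simp [kleinFun, h]

lemma kleinAdd_self (u : Bool × Bool) : kleinAdd u u = (false, false) := by simp [kleinAdd]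

/-- The elements `1, b, c, d` of the Grigorchuk group. -/
def klein (u : Bool × Bool) : Perm (ℕ → Bool) where
  toFun := kleinFun u
  invFun := kleinFun u
  left_inv x := by funext n; rw [kleinFun_add, kleinAdd_self, kleinFun_zero]
  right_inv x := by funext n; rw [kleinFun_add, kleinAdd_self, kleinFun_zero]

lemma klein_eq_pair (u : Bool × Bool) : klein u = pair (flipIf u.1) (klein (next u)) := by
  ext1 x; exact kleinFun_eq u x

lemma klein_mul (u v : Bool × Bool) : klein u * klein v = klein (kleinAdd u v) := by
  ext1 x; funext n; exact kleinFun_add u v x n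

@[simp] lemma klein_zero : klein (false, false) = 1 := by
  ext1 x; funext n; exact kleinFun_zero x n

@[simp] lemma klein_mul_self (u : Bool × Bool) : klein u * klein u = 1 := by
  rw [klein_mul, kleinAdd_self, klein_zero]

@[simp] lemma klein_inv (u : Bool × Bool) : (klein u)⁻¹ = klein u := by
  rw [inv_eq_iff_mul_eq_one]; simp

/-- The standard generators `a, b, c, d`. -/
def gens : Set (Perm (ℕ → Bool)) :=
  {flip, klein (true, true), klein (true, false), klein (false, true)}

lemma finite_gens : gens.Finite := by simp [gens]

lemma inv_eq_self_of_mem_gens {s : Perm (ℕ → Bool)} (hs : s ∈ gens) : s⁻¹ = s := by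
  rcases hs with rfl | rfl | rfl | rfl <;> simp

/-- The Grigorchuk group. -/
def group : Subgroup (Perm (ℕ → Bool)) := Subgroup.closure gens

lemma flip_mem_gens : flip ∈ gens := by simp [gens]

lemma klein_mem_gens {u : Bool × Bool} (hu : u ≠ (false, false)) : klein u ∈ gens := by
  rcases u with ⟨_ | _, _ | _⟩ <;> simp_all [gens]

lemma flip_mem : flip ∈ group := Subgroup.subset_closure flip_mem_gens

lemma klein_mem (u : Bool × Bool) : klein u ∈ group := by
  by_cases hu : u = (false, false)
  · rw [hu, klein_zero]; exact one_mem _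
  · exact Subgroup.subset_closure (klein_mem_gens hu)

end Grigorchuk

/-! ### Balls in groups -/

section Ball

variable {G : Type*} [Group G] {S : Set G}

lemma one_mem_ball (n : ℕ) : (1 : G) ∈ ball S n := ⟨[], by simp⟩

lemma mul_mem_ball_add {g h : G} {m n : ℕ} (hg : g ∈ ball S m) (hh : h ∈ ball S n) :
    g * h ∈ ball S (m + n) := by
  obtain ⟨l, hl, hS, rfl⟩ := hg
  obtain ⟨l', hl', hS', rfl⟩ := hh
  refine ⟨l ++ l', by simp; omega, fun x hx => ?_, by simp⟩
  rcases List.mem_append.1 hx with h | h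
  exacts [hS x h, hS' x h]

lemma mem_ball_one {s : G} (hs : s ∈ S) : s ∈ ball S 1 := ⟨[s], by simp [hs]⟩

lemma ball_mono {m n : ℕ} (h : m ≤ n) : ball S m ⊆ ball S n := by
  rintro g ⟨l, hl, hS, rfl⟩
  exact ⟨l, hl.trans h, hS, rfl⟩

/-- Induction on the balls with respect to a set of involutions. -/
lemma ball_induction (hS : ∀ s ∈ S, s⁻¹ = s) {P : ℕ → G → Prop} (one : ∀ n, P n 1)
    (mul : ∀ n, ∀ s ∈ S, ∀ g, P n g → P (n + 1) (s * g)) {n : ℕ} {g : G} (hg : g ∈ ball S n) :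
    P n g := by
  obtain ⟨l, hl, hlS, rfl⟩ := hg
  induction l generalizing n with
  | nil => exact one n
  | cons s l ih =>
    rw [List.length_cons] at hl
    obtain ⟨n, rfl⟩ : ∃ k, n = k + 1 := ⟨n - 1, by omega⟩
    rw [List.prod_cons]
    refine mul n s ?_ _ (ih (by omega) fun x hx => hlS x (List.mem_cons_of_mem _ hx))
    rcases hlS s List.mem_cons_self with h | h
    · exact h
    · have := hS _ h
      rw [inv_inv] at this
      rwa [this]

lemma mem_closure_iff_exists_mem_ball {g : G} :
    g ∈ Subgroup.closure S ↔ ∃ n, g ∈ ball S n := by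
  constructor
  · intro hg
    rw [← Subgroup.mem_toSubmonoid, Subgroup.closure_toSubmonoid] at hg
    obtain ⟨l, hl, rfl⟩ := Submonoid.exists_list_of_mem_closure hg
    exact ⟨l.length, l, le_rfl, hl, rfl⟩
  · rintro ⟨n, l, -, hl, rfl⟩
    refine Subgroup.list_prod_mem _ fun x hx => ?_
    rcases hl x hx with h | h
    · exact Subgroup.subset_closure h
    · exact inv_mem_iff.1 (Subgroup.subset_closure h)

lemma ball_finite_and_ncard_le (hS : ∀ s ∈ S, s⁻¹ = s) (hfin : S.Finite) (n : ℕ) :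
    (ball S n).Finite ∧ (ball S n).ncard ≤ (S.ncard + 1) ^ n := by
  classical
  suffices ∃ F : Finset G, ball S n ⊆ F ∧ F.card ≤ (S.ncard + 1) ^ n by
    obtain ⟨F, hF, hc⟩ := this
    refine ⟨F.finite_toSet.subset hF, le_trans ?_ hc⟩
    rw [← Set.ncard_coe_finset]
    exact Set.ncard_le_ncard hF F.finite_toSet
  have hF : ∀ n, ∃ F : Finset G, (1 ∈ F ∧ ball S n ⊆ F) ∧ F.card ≤ (S.ncard + 1) ^ n := by
    intro n
    induction n with
    | zero =>
      refine ⟨{1}, ⟨by simp, ?_⟩, by simp⟩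
      rintro g ⟨l, hl, -, rfl⟩
      simp [List.length_eq_zero_iff.1 (Nat.le_zero.1 hl)]
    | succ n ih =>
      obtain ⟨F, ⟨h1, hF⟩, hc⟩ := ih
      refine ⟨(insert 1 hfin.toFinset ×ˢ F).image fun p => p.1 * p.2, ⟨?_, ?_⟩, ?_⟩
      · exact Finset.mem_image.2 ⟨(1, 1), by simp [h1], by simp⟩
      · rintro g ⟨l, hl, hlS, rfl⟩
        rw [Finset.mem_coe, Finset.mem_image]
        cases l with
        | nil => exact ⟨(1, 1), by simp [h1], by simp⟩
        | cons s l =>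
          refine ⟨(s, l.prod), ?_, by simp⟩
          have hs : s ∈ S := by
            rcases hlS s List.mem_cons_self with h | h
            · exact h
            · have := hS _ h
              rw [inv_inv] at this
              rwa [this]
          simp only [Finset.mem_product, Finset.mem_insert, Set.Finite.mem_toFinset, hs, or_true,
            true_and]
          exact hF ⟨l, by simpa using hl, fun x hx => hlS x (List.mem_cons_of_mem _ hx), rfl⟩
      · refine Finset.card_image_le.trans ?_
        rw [Finset.card_product, pow_succ, mul_comm]
        refine Nat.mul_le_mul hc ((Finset.card_insert_le _ _).trans ?_)
        rw [Set.ncard_eq_toFinset_card _ hfin]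
  obtain ⟨F, ⟨-, h⟩, hc⟩ := hF n
  exact ⟨F, h, hc⟩

lemma image_ball {H : Type*} [Group H] (f : G →* H) (n : ℕ) : f '' ball S n = ball (f '' S) n := by
  ext h
  constructor
  · rintro ⟨g, ⟨l, hl, hS, rfl⟩, rfl⟩
    refine ⟨l.map f, by simpa using hl, fun x hx => ?_, (map_list_prod f l).symm⟩
    obtain ⟨y, hy, rfl⟩ := List.mem_map.1 hx
    exact (hS y hy).imp (fun h => ⟨y, h, rfl⟩) fun h => ⟨y⁻¹, h, by simp⟩
  · rintro ⟨l, hl, hS, rfl⟩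
    have : ∀ l : List H, (∀ x ∈ l, x ∈ f '' S ∨ x⁻¹ ∈ f '' S) →
        ∃ l' : List G, l'.length = l.length ∧ (∀ x ∈ l', x ∈ S ∨ x⁻¹ ∈ S) ∧ f l'.prod = l.prod := by
      intro l
      induction l with
      | nil => exact fun _ => ⟨[], by simp⟩
      | cons x l ih =>
        intro h
        obtain ⟨l', h1, h2, h3⟩ := ih fun y hy => h y (List.mem_cons_of_mem _ hy)
        obtain ⟨y, hy, hyx⟩ : ∃ y, (y ∈ S ∨ y⁻¹ ∈ S) ∧ f y = x := by
          rcases h x List.mem_cons_self with ⟨y, hy, hyx⟩ | ⟨y, hy, hyx⟩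
          · exact ⟨y, Or.inl hy, hyx⟩
          · exact ⟨y⁻¹, Or.inr (by simpa using hy), by simp [hyx]⟩
        refine ⟨y :: l', by simp [h1], ?_, by simp [h3, hyx]⟩
        intro z hz
        rcases List.mem_cons.1 hz with rfl | hz
        exacts [hy, h2 z hz]
    obtain ⟨l', h1, h2, h3⟩ := this l hS
    exact ⟨l'.prod, ⟨l', h1 ▸ hl, h2, rfl⟩, h3⟩

end Ball

namespace Grigorchuk

lemma finite_ball (n : ℕ) : (ball gens n).Finite :=
  (ball_finite_and_ncard_le (fun _ => inv_eq_self_of_mem_gens) finite_gens n).1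

/-! ### Lifting elements to one coordinate, and superpolynomial growth -/

/-- The finite dihedral group generated by `a` and `d`. -/
def dihedral : Set (Perm (ℕ → Bool)) :=
  Set.range fun p : Bool × Bool × Bool =>
    pair (if p.1 then klein (true, true) else 1) (if p.2.1 then klein (true, true) else 1) *
      flipIf p.2.2

lemma finite_dihedral : dihedral.Finite := Set.finite_range _

lemma one_mem_dihedral : 1 ∈ dihedral := ⟨(false, false, false), by simp⟩

lemma flip_mul_mem_dihedral {t : Perm (ℕ → Bool)} (ht : t ∈ dihedral) : flip * t ∈ dihedral := by
  obtain ⟨⟨i, j, k⟩, rfl⟩ := ht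
  refine ⟨(j, i, !k), ?_⟩
  dsimp only
  rw [← mul_assoc, flip_mul_pair, mul_assoc]
  cases k <;> simp

lemma klein_mul_mem_dihedral {t : Perm (ℕ → Bool)} (ht : t ∈ dihedral) :
    klein (false, true) * t ∈ dihedral := by
  obtain ⟨⟨i, j, k⟩, rfl⟩ := ht
  refine ⟨(i, !j, k), ?_⟩
  dsimp only
  rw [klein_eq_pair (false, true), ← mul_assoc, pair_mul]
  cases j <;> simp [next]

lemma exists_pair_mem_ball {n : ℕ} {g : Perm (ℕ → Bool)} (hg : g ∈ ball gens n) :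
    ∃ t ∈ dihedral, pair t g ∈ ball gens (3 * n) := by
  refine ball_induction (P := fun n g => ∃ t ∈ dihedral, pair t g ∈ ball gens (3 * n))
    (fun _ => inv_eq_self_of_mem_gens) (fun n => ⟨1, one_mem_dihedral, ?_⟩) ?_ hg
  · rw [pair_one]; exact one_mem_ball _
  · rintro n s hs g ⟨t, ht, hg⟩
    have key : ∀ t', t' * t ∈ dihedral → pair t' s ∈ ball gens 3 →
        ∃ t ∈ dihedral, pair t (s * g) ∈ ball gens (3 * (n + 1)) := by
      intro t' ht' h
      refine ⟨_, ht', ?_⟩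
      rw [← pair_mul, mul_add, add_comm]
      exact mul_mem_ball_add h hg
    have hk : ∀ u, u ≠ (false, false) → pair (flipIf u.1) (klein (next u)) ∈ ball gens 3 := by
      intro u hu
      rw [← klein_eq_pair]
      exact ball_mono (by norm_num) (mem_ball_one (klein_mem_gens hu))
    rcases hs with rfl | rfl | rfl | rfl
    · refine key _ (klein_mul_mem_dihedral ht) ?_
      have : pair (klein (false, true)) flip = flip * klein (true, false) * flip := by
        rw [klein_eq_pair (true, false), flip_mul_pair, mul_assoc]; simp [next]
      rw [this]
      have hf := mem_ball_one flip_mem_gens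
      exact mul_mem_ball_add (mul_mem_ball_add hf (mem_ball_one (klein_mem_gens (by simp)))) hf
    · exact key 1 (by simpa using ht) (hk (false, true) (by simp))
    · exact key flip (flip_mul_mem_dihedral ht) (hk (true, true) (by simp))
    · exact key flip (flip_mul_mem_dihedral ht) (hk (true, false) (by simp))

lemma exists_pair_mem {g : Perm (ℕ → Bool)} (hg : g ∈ group) : ∃ t, pair t g ∈ group := by
  obtain ⟨n, hn⟩ := mem_closure_iff_exists_mem_ball.1 hg
  obtain ⟨t, -, ht⟩ := exists_pair_mem_ball hn
  exact ⟨t, mem_closure_iff_exists_mem_ball.2 ⟨_, ht⟩⟩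

lemma ncard_ball_sq_le (n : ℕ) :
    (ball gens n).ncard ^ 2 ≤ (ball gens (6 * n + 2)).ncard * dihedral.ncard ^ 2 := by
  choose! t htD ht using fun g => exists_pair_mem_ball (n := n) (g := g)
  rw [sq, sq, ← Set.ncard_prod, ← Set.ncard_prod, ← Set.ncard_prod]
  refine Set.ncard_le_ncard_of_injOn
    (fun p => (pair (p.1 * t p.2) (t p.1 * p.2), t p.1, t p.2)) ?_ ?_
    ((finite_ball _).prod (finite_dihedral.prod finite_dihedral))
  · rintro ⟨g, h⟩ ⟨hg, hh⟩
    refine ⟨?_, htD g hg, htD h hh⟩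
    have : pair (g * t h) (t g * h) = flip * pair (t g) g * flip * pair (t h) h := by
      rw [flip_mul_pair, mul_assoc (pair _ _), flip_mul_flip, mul_one, pair_mul]
    dsimp only at *
    rw [this]
    have hf := mem_ball_one flip_mem_gens
    exact ball_mono (by omega)
      (mul_mem_ball_add (mul_mem_ball_add (mul_mem_ball_add hf (ht g hg)) hf) (ht h hh))
  · rintro ⟨g, h⟩ - ⟨g', h'⟩ - heq
    simp only [Prod.mk.injEq] at heq
    obtain ⟨h1, h2, h3⟩ := heq
    obtain ⟨h4, h5⟩ := pair_injective h1
    rw [h3] at h4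
    rw [h2] at h5
    simp only [Prod.mk.injEq]
    exact ⟨mul_right_cancel h4, mul_left_cancel h5⟩

lemma exists_mem_agree (n : ℕ) (x y : ℕ → Bool) : ∃ g ∈ group, ∀ i < n, g x i = y i := by
  induction n generalizing x y with
  | zero => exact ⟨1, one_mem _, by simp⟩
  | succ n ih =>
    obtain ⟨g, hg, hgy⟩ := ih (tail x) (tail y)
    obtain ⟨t, ht⟩ := exists_pair_mem hg
    have key : ∃ g ∈ group, g x 0 = x 0 ∧ ∀ i < n, g x (i + 1) = y (i + 1) := by
      by_cases h : x 0
      · refine ⟨_, ht, ?_⟩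
        simpa [pair_apply, h] using hgy
      · refine ⟨_, mul_mem (mul_mem flip_mem ht) flip_mem, ?_⟩
        simpa [pair_apply, flip_apply, h] using hgy
    obtain ⟨g', hg', h0, h1⟩ := key
    by_cases hxy : x 0 = y 0
    · refine ⟨g', hg', fun i hi => ?_⟩
      cases i with
      | zero => rw [h0, hxy]
      | succ i => exact h1 i (by omega)
    · refine ⟨flip * g', mul_mem flip_mem hg', fun i hi => ?_⟩
      cases i with
      | zero => simpa [flip_apply, h0] using Bool.eq_not_of_ne hxy |>.symm ▸ by simp
      | succ i => simpa [flip_apply] using h1 i (by omega)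

lemma infinite_group : (group : Set (Perm (ℕ → Bool))).Infinite := by
  choose g hg hgy using fun n : ℕ =>
    exists_mem_agree (n + 1) (fun _ => true) (fun i => decide (i < n))
  refine Set.infinite_of_injective_forall_mem (f := g) (fun m n hmn => ?_) hg
  by_contra hne
  wlog hlt : m < n generalizing m n
  · exact this n m hmn.symm (Ne.symm hne) (by omega)
  have h1 := hgy m m (by omega)
  have h2 := hgy n m (by omega)
  rw [hmn, h2] at h1
  simp [hlt] at h1

lemma exists_lt_ncard_ball (M : ℕ) : ∃ n, M < (ball gens n).ncard := by
  obtain ⟨F, hF, hc⟩ := infinite_group.exists_subset_card_eq (M + 1)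
  have : ∃ n, (F : Set (Perm (ℕ → Bool))) ⊆ ball gens n := by
    choose! k hk using fun g (hg : g ∈ group) => mem_closure_iff_exists_mem_ball.1 hg
    refine ⟨F.sup k, fun g hg => ball_mono (Finset.le_sup hg) (hk g (hF hg))⟩
  obtain ⟨n, hn⟩ := this
  refine ⟨n, ?_⟩
  have := Set.ncard_le_ncard hn (finite_ball n)
  rw [Set.ncard_coe_finset] at this
  omega

lemma superpolynomial (d : ℕ) : ∃ n : ℕ, n ^ d < (ball gens n).ncard := by
  set D := dihedral.ncard ^ 2
  obtain ⟨n₀, hn₀⟩ := exists_lt_ncard_ball (2 * D)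
  have hD : 0 < D := by
    have : 0 < dihedral.ncard := (Set.ncard_pos finite_dihedral).2 ⟨1, one_mem_dihedral⟩
    positivity
  have key : ∀ k : ℕ, ∃ n ≤ 8 ^ k * (n₀ + 1), D * 2 ^ 2 ^ k < (ball gens n).ncard := by
    intro k
    induction k with
    | zero => exact ⟨n₀, by omega, by simpa [mul_comm] using hn₀⟩
    | succ k ih =>
      obtain ⟨n, hn, hc⟩ := ih
      refine ⟨6 * n + 2, ?_, ?_⟩
      · have : 1 ≤ 8 ^ k * (n₀ + 1) := Nat.succ_le_of_lt (by positivity)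
        rw [pow_succ]
        nlinarith
      · have h1 := ncard_ball_sq_le n
        have h2 : (D * 2 ^ 2 ^ k) ^ 2 < (ball gens n).ncard ^ 2 := Nat.pow_lt_pow_left hc (by simp)
        have h3 := h2.trans_le h1
        have h4 : (D * 2 ^ 2 ^ k) ^ 2 = (D * 2 ^ 2 ^ (k + 1)) * D := by
          rw [mul_pow, ← pow_mul, pow_succ 2 k]; ring
        rw [h4] at h3
        exact Nat.lt_of_mul_lt_mul_right h3
  obtain ⟨k, hk⟩ : ∃ k : ℕ, (3 * k + (n₀ + 1)) * d < 2 ^ k := by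
    have h1 : Filter.Tendsto (fun k : ℕ => (k : ℝ) ^ 2 / 2 ^ k) Filter.atTop (nhds 0) :=
      tendsto_pow_const_div_const_pow_of_one_lt 2 (by norm_num)
    obtain ⟨k, hk, hk'⟩ := ((h1.eventually_lt_const one_pos).and
      (Filter.eventually_ge_atTop ((3 + (n₀ + 1)) * d + 1))).exists
    refine ⟨k, ?_⟩
    rw [div_lt_one (by positivity)] at hk
    have h2 : k ^ 2 < 2 ^ k := by exact_mod_cast hk
    have h3 : 1 ≤ k := by omega
    calc (3 * k + (n₀ + 1)) * d ≤ (3 * k + (n₀ + 1) * k) * d :=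
          Nat.mul_le_mul_right _ (by nlinarith)
      _ = (3 + (n₀ + 1)) * d * k := by ring
      _ ≤ k * k := Nat.mul_le_mul_right _ (by omega)
      _ < 2 ^ k := by rwa [← sq]
  obtain ⟨n, hn, hc⟩ := key k
  refine ⟨n, lt_of_le_of_lt ?_ hc⟩
  calc n ^ d ≤ (8 ^ k * (n₀ + 1)) ^ d := Nat.pow_le_pow_left hn d
    _ ≤ (2 ^ (3 * k) * 2 ^ (n₀ + 1)) ^ d := by
      refine Nat.pow_le_pow_left (Nat.mul_le_mul ?_ Nat.lt_two_pow_self.le) d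
      rw [pow_mul]; norm_num
    _ = 2 ^ ((3 * k + (n₀ + 1)) * d) := by rw [← pow_add, ← pow_mul]
    _ ≤ 2 ^ 2 ^ k := Nat.pow_le_pow_right (by norm_num) hk.le
    _ ≤ D * 2 ^ 2 ^ k := Nat.le_mul_of_pos_left _ hD

/-! ### Subexponential growth -/

/-- The weights of `1, b, c, d`; the generator `a` has weight `7`. -/
def weight : Bool × Bool → ℕ
  | (false, false) => 0
  | (true, true) => 8
  | (true, false) => 5
  | (false, true) => 3

/-- `Weight w g` says that `g` is represented by a word `u₀ a u₁ a ⋯ a uₖ`, with the `uᵢ` in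
`{1, b, c, d}`, of total weight at most `w`. -/
inductive Weight : ℕ → Perm (ℕ → Bool) → Prop
  | base (u : Bool × Bool) (w : ℕ) (h : weight u ≤ w) : Weight w (klein u)
  | step (u : Bool × Bool) (w w' : ℕ) (g : Perm (ℕ → Bool)) (hg : Weight w g)
      (h : w + weight u + 7 ≤ w') : Weight w' (klein u * (flip * g))

lemma Weight.mono {w w' : ℕ} {g : Perm (ℕ → Bool)} (hg : Weight w g) (h : w ≤ w') :
    Weight w' g := by
  cases hg with
  | base u _ hu => exact .base u _ (hu.trans h)
  | step u w₁ _ g hg hw => exact .step u w₁ _ g hg (hw.trans h)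

lemma weight_add_le (u v : Bool × Bool) : weight (kleinAdd u v) ≤ weight u + weight v := by
  rcases u with ⟨_ | _, _ | _⟩ <;> rcases v with ⟨_ | _, _ | _⟩ <;> simp [kleinAdd, weight]

lemma Weight.klein_mul {w : ℕ} {g : Perm (ℕ → Bool)} (hg : Weight w g) (u : Bool × Bool) :
    Weight (w + weight u) (klein u * g) := by
  cases hg with
  | base v _ hv =>
    rw [Grigorchuk.klein_mul]
    exact .base _ _ ((weight_add_le u v).trans (by omega))
  | step v w₁ _ g hg hw =>
    rw [← mul_assoc, Grigorchuk.klein_mul]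
    have := weight_add_le u v
    exact .step _ w₁ _ g hg (by omega)

lemma Weight.flip_mul {w : ℕ} {g : Perm (ℕ → Bool)} (hg : Weight w g) :
    Weight (w + 7) (flip * g) := by
  simpa using Weight.step (false, false) w (w + 7) g hg (by simp [weight])

lemma Weight.flipIf_mul {w : ℕ} {g : Perm (ℕ → Bool)} (hg : Weight w g) (p : Bool) :
    Weight (w + if p then 7 else 0) (flipIf p * g) := by
  cases p
  · simpa using hg
  · simpa using hg.flip_mul

lemma Weight.one : Weight 0 1 := by
  simpa using Weight.base (false, false) 0 le_rfl

lemma weight_contract (u : Bool × Bool) :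
    6 * ((if u.1 then 7 else 0) + weight (next u)) ≤ 5 * (weight u + 7) := by
  rcases u with ⟨_ | _, _ | _⟩ <;> simp [next, weight]

lemma Weight.exists_pair {w : ℕ} {g : Perm (ℕ → Bool)} (hg : Weight w g) :
    ∃ p w₀ w₁ g₀ g₁, Weight w₀ g₀ ∧ Weight w₁ g₁ ∧ 6 * (w₀ + w₁) ≤ 5 * (w + 7) ∧
      g = pair g₀ g₁ * flipIf p := by
  induction hg with
  | base u w h =>
    have := weight_contract u
    refine ⟨false, if u.1 then 7 else 0, _, flipIf u.1, klein (next u), ?_, .base _ _ le_rfl,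
      ?_, ?_⟩
    · simpa using Weight.one.flipIf_mul u.1
    · omega
    · simpa using klein_eq_pair u
  | step u w w' g _ h ih =>
    obtain ⟨p, w₀, w₁, g₀, g₁, h₀, h₁, hw, rfl⟩ := ih
    have := weight_contract u
    refine ⟨!p, _, _, _, _, h₁.flipIf_mul u.1, h₀.klein_mul (next u), by omega, ?_⟩
    rw [← mul_assoc flip, flip_mul_pair, ← pair_mul, ← klein_eq_pair]
    cases p <;> simp [mul_assoc]

lemma Weight.mem_ball {w : ℕ} {g : Perm (ℕ → Bool)} (hg : Weight w g) : g ∈ ball gens w := by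
  have hk : ∀ u, klein u ∈ ball gens (weight u) := by
    intro u
    by_cases hu : u = (false, false)
    · rw [hu, klein_zero]; exact one_mem_ball _
    · refine ball_mono ?_ (mem_ball_one (klein_mem_gens hu))
      rcases u with ⟨_ | _, _ | _⟩ <;> simp_all [weight]
  induction hg with
  | base u w h => exact ball_mono h (hk u)
  | step u w w' g _ h ih =>
    exact ball_mono (by omega)
      (mul_mem_ball_add (hk u) (mul_mem_ball_add (mem_ball_one flip_mem_gens) ih))

lemma weight_of_mem_ball {n : ℕ} {g : Perm (ℕ → Bool)} (hg : g ∈ ball gens n) :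
    Weight (8 * n) g := by
  refine ball_induction (P := fun n g => Weight (8 * n) g) (fun _ => inv_eq_self_of_mem_gens)
    (fun n => Weight.one.mono (Nat.zero_le _)) ?_ hg
  rintro n s hs g hg
  rcases hs with rfl | rfl | rfl | rfl
  · exact hg.flip_mul.mono (by omega)
  all_goals exact (hg.klein_mul _).mono (by simp [weight]; omega)

lemma finite_weight (w : ℕ) : {g | Weight w g}.Finite :=
  (finite_ball w).subset fun _ hg => hg.mem_ball

lemma ncard_weight_le_sum {w m : ℕ} (hm : 5 * (w + 7) ≤ 6 * m + 5) :
    {g | Weight w g}.ncard ≤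
      2 * ∑ i ∈ Finset.range (m + 1), {g | Weight i g}.ncard * {g | Weight (m - i) g}.ncard := by
  classical
  let F : ℕ → Finset (Perm (ℕ → Bool)) := fun w => (finite_weight w).toFinset
  have hF : ∀ w, {g | Weight w g}.ncard = (F w).card := fun w =>
    Set.ncard_eq_toFinset_card _ (finite_weight w)
  simp only [hF]
  have hsub : F w ⊆ (Finset.univ ×ˢ (Finset.range (m + 1)).biUnion fun i => F i ×ˢ F (m - i)).image
      fun q : Bool × Perm (ℕ → Bool) × Perm (ℕ → Bool) => pair q.2.1 q.2.2 * flipIf q.1 := by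
    intro g hg
    obtain ⟨p, w₀, w₁, g₀, g₁, h₀, h₁, hw, rfl⟩ :=
      Weight.exists_pair ((finite_weight w).mem_toFinset.1 hg)
    refine Finset.mem_image.2 ⟨(p, g₀, g₁), ?_, rfl⟩
    simp only [Finset.mem_product, Finset.mem_univ, true_and, Finset.mem_biUnion, Finset.mem_range]
    exact ⟨w₀, by omega, (finite_weight _).mem_toFinset.2 h₀,
      (finite_weight _).mem_toFinset.2 (h₁.mono (by omega))⟩
  refine (Finset.card_le_card hsub).trans (Finset.card_image_le.trans ?_)
  rw [Finset.card_product]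
  simp only [Finset.card_univ, Fintype.card_bool]
  refine Nat.mul_le_mul_left _ (Finset.card_biUnion_le.trans ?_)
  simp [Finset.card_product]

lemma exists_ncard_weight_le_exp_mul {s C : ℝ} (hs : 0 < s)
    (h : ∀ w : ℕ, ({g | Weight w g}.ncard : ℝ) ≤ C * Real.exp (s * w)) :
    ∃ C' : ℝ, ∀ w : ℕ, ({g | Weight w g}.ncard : ℝ) ≤ C' * Real.exp (7 / 8 * s * w) := by
  obtain ⟨K, hK0, hK⟩ : ∃ K : ℝ, 0 ≤ K ∧ ∀ m : ℕ, (m + 1 : ℝ) ≤ K * Real.exp (s / 20 * m) := by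
    refine ⟨1 + 20 / s, by positivity, fun m => ?_⟩
    have h1 := Real.add_one_le_exp (s / 20 * m)
    have h2 : 0 ≤ 20 / s := by positivity
    calc (m + 1 : ℝ) ≤ (1 + 20 / s) * (s / 20 * m + 1) := by
          have : (1 + 20 / s) * (s / 20 * m + 1) = s / 20 * m + 1 + m + 20 / s := by
            field_simp
            ring
          rw [this]
          have : 0 ≤ s / 20 * m := by positivity
          linarith
      _ ≤ _ := by gcongr
  refine ⟨2 * C ^ 2 * K * Real.exp (s * (21 / 20) * (35 / 6)), fun w => ?_⟩
  obtain ⟨m, hm1, hm2⟩ : ∃ m : ℕ, 6 * m ≤ 5 * (w + 7) ∧ 5 * (w + 7) ≤ 6 * m + 5 :=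
    ⟨5 * (w + 7) / 6, by omega, by omega⟩
  have hm : (m : ℝ) ≤ 5 / 6 * w + 35 / 6 := by
    have : (6 * m : ℝ) ≤ 5 * (w + 7) := by exact_mod_cast hm1
    linarith
  have hsum : (∑ i ∈ Finset.range (m + 1),
      ({g | Weight i g}.ncard : ℝ) * ({g | Weight (m - i) g}.ncard : ℝ)) ≤
        ∑ i ∈ Finset.range (m + 1), C ^ 2 * Real.exp (s * m) := by
    refine Finset.sum_le_sum fun i hi => ?_
    have hi' : i ≤ m := by simpa [Nat.lt_succ_iff] using hi
    calc _ ≤ (C * Real.exp (s * i)) * (C * Real.exp (s * (m - i : ℕ))) :=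
          mul_le_mul (h _) (h _) (by positivity) ((Nat.cast_nonneg _).trans (h i))
      _ = C ^ 2 * (Real.exp (s * i) * Real.exp (s * (m - i : ℕ))) := by ring
      _ = _ := by
        rw [← Real.exp_add, Nat.cast_sub hi']
        ring_nf
  have hcard : ({g | Weight w g}.ncard : ℝ) ≤ 2 * ∑ i ∈ Finset.range (m + 1),
      ({g | Weight i g}.ncard : ℝ) * ({g | Weight (m - i) g}.ncard : ℝ) := by
    exact_mod_cast ncard_weight_le_sum hm2
  calc ({g | Weight w g}.ncard : ℝ)
      ≤ 2 * ∑ i ∈ Finset.range (m + 1), C ^ 2 * Real.exp (s * m) := by linarith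
    _ = 2 * C ^ 2 * (m + 1) * Real.exp (s * m) := by
      rw [Finset.sum_const, Finset.card_range, nsmul_eq_mul]; push_cast; ring
    _ ≤ 2 * C ^ 2 * (K * Real.exp (s / 20 * m)) * Real.exp (s * m) := by gcongr; exact hK m
    _ = 2 * C ^ 2 * K * Real.exp (s * (21 / 20) * m) := by
      rw [mul_assoc (2 * C ^ 2), mul_assoc K, ← Real.exp_add]
      ring_nf
    _ ≤ 2 * C ^ 2 * K * Real.exp (s * (21 / 20) * (5 / 6 * w + 35 / 6)) := by gcongr
    _ = _ := by
      rw [mul_assoc (2 * C ^ 2 * K), ← Real.exp_add]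
      ring_nf

lemma exists_ncard_weight_le_exp {s : ℝ} (hs : 0 < s) :
    ∃ C : ℝ, ∀ w : ℕ, ({g | Weight w g}.ncard : ℝ) ≤ C * Real.exp (s * w) := by
  have h0 : ∃ s₀ : ℝ, 0 < s₀ ∧
      ∃ C : ℝ, ∀ w : ℕ, ({g | Weight w g}.ncard : ℝ) ≤ C * Real.exp (s₀ * w) := by
    refine ⟨Real.log (gens.ncard + 2),
      Real.log_pos (by linarith [Nat.cast_nonneg (α := ℝ) gens.ncard]), 1, fun w => ?_⟩
    rw [one_mul, mul_comm, Real.exp_nat_mul, Real.exp_log (by positivity)]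
    have h1 : {g | Weight w g}.ncard ≤ (gens.ncard + 1) ^ w :=
      (Set.ncard_le_ncard (fun _ hg => hg.mem_ball) (finite_ball w)).trans
        (ball_finite_and_ncard_le (fun _ => inv_eq_self_of_mem_gens) finite_gens w).2
    calc ({g | Weight w g}.ncard : ℝ) ≤ ((gens.ncard + 1) ^ w : ℕ) := by exact_mod_cast h1
      _ = (gens.ncard + 1 : ℝ) ^ w := by push_cast; rfl
      _ ≤ _ := by gcongr; norm_num
  obtain ⟨s₀, hs₀, h0⟩ := h0
  have hk : ∀ k : ℕ, ∃ C : ℝ, ∀ w : ℕ,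
      ({g | Weight w g}.ncard : ℝ) ≤ C * Real.exp ((7 / 8) ^ k * s₀ * w) := by
    intro k
    induction k with
    | zero => simpa using h0
    | succ k ih =>
      obtain ⟨C, hC⟩ := ih
      obtain ⟨C', hC'⟩ := exists_ncard_weight_le_exp_mul (by positivity) hC
      refine ⟨C', fun w => (hC' w).trans (le_of_eq ?_)⟩
      ring_nf
  obtain ⟨k, hk'⟩ := exists_pow_lt_of_lt_one (div_pos hs hs₀) (by norm_num : (7 / 8 : ℝ) < 1)
  rw [lt_div_iff₀ hs₀] at hk'
  obtain ⟨C, hC⟩ := hk k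
  refine ⟨C, fun w => (hC w).trans ?_⟩
  have hC0 : 0 ≤ C := by
    have := (Nat.cast_nonneg _).trans (hC 0)
    simpa using this
  gcongr

lemma subexponential :
    Filter.Tendsto (fun n : ℕ => ((ball gens n).ncard : ℝ) ^ ((n : ℝ)⁻¹))
      Filter.atTop (nhds 1) := by
  have hpos : ∀ n, (1 : ℝ) ≤ (ball gens n).ncard := fun n => by
    exact_mod_cast (Set.ncard_pos (finite_ball n)).2 ⟨1, one_mem_ball n⟩
  refine tendsto_order.2 ⟨fun r hr => .of_forall fun n => hr.trans_le ?_, fun r hr => ?_⟩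
  · exact Real.one_le_rpow (hpos n) (by positivity)
  · obtain ⟨q, hq1, hqr⟩ := exists_between hr
    have hlog : 0 < Real.log q := Real.log_pos hq1
    obtain ⟨C, hC⟩ := exists_ncard_weight_le_exp (s := Real.log q / 8) (by positivity)
    have hle : ∀ n : ℕ, ((ball gens n).ncard : ℝ) ≤ C * q ^ n := fun n => by
      calc ((ball gens n).ncard : ℝ) ≤ ({g | Weight (8 * n) g}.ncard : ℝ) := by
            exact_mod_cast Set.ncard_le_ncard (fun _ => weight_of_mem_ball) (finite_weight _)
        _ ≤ C * Real.exp (Real.log q / 8 * (8 * n : ℕ)) := hC _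
        _ = C * q ^ n := by
          have : Real.log q / 8 * (8 * n : ℕ) = n * Real.log q := by push_cast; ring
          rw [this, Real.exp_nat_mul, Real.exp_log (by linarith)]
    have hC1 : 0 < C := by
      have := (hpos 0).trans (hle 0)
      simp at this
      linarith
    have hlim : Filter.Tendsto (fun n : ℕ => C ^ ((n : ℝ)⁻¹) * q) Filter.atTop (nhds (1 * q)) := by
      refine Filter.Tendsto.mul_const _ ?_
      have := (Real.continuousAt_const_rpow (b := 0) hC1.ne').tendsto.comp
        (tendsto_inv_atTop_nhds_zero_nat (𝕜 := ℝ))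
      simpa [Function.comp_def] using this
    rw [one_mul] at hlim
    filter_upwards [hlim.eventually_lt_const hqr, Filter.eventually_ne_atTop 0] with n hn hn0
    refine lt_of_le_of_lt ?_ hn
    calc ((ball gens n).ncard : ℝ) ^ ((n : ℝ)⁻¹) ≤ (C * q ^ n) ^ ((n : ℝ)⁻¹) :=
          Real.rpow_le_rpow (by positivity) (hle n) (by positivity)
      _ = C ^ ((n : ℝ)⁻¹) * q := by
        rw [Real.mul_rpow hC1.le (by positivity), Real.pow_rpow_inv_natCast (by linarith) hn0]

/-! ### The action on cylinders and weak branching -/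

lemma kleinFun_congr (n : ℕ) (u : Bool × Bool) {x y : ℕ → Bool} (h : ∀ i ≤ n, y i = x i) :
    kleinFun u y n = kleinFun u x n := by
  induction n generalizing u x y with
  | zero => exact h 0 le_rfl
  | succ n ih =>
    have h' : ∀ i ≤ n, tail y i = tail x i := fun i hi => h (i + 1) (by omega)
    rw [kleinFun, kleinFun, h 0 (Nat.zero_le _), ih _ h']
    congr 1
    cases u.1
    · exact h' n le_rfl
    · cases n with
      | zero => exact congrArg not (h' 0 le_rfl)
      | succ n => exact h' (n + 1) le_rfl

lemma apply_congr {g : Perm (ℕ → Bool)} (hg : g ∈ group) {n : ℕ} {x y : ℕ → Bool}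
    (h : ∀ i < n, y i = x i) : ∀ i < n, g y i = g x i := by
  obtain ⟨m, hm⟩ := mem_closure_iff_exists_mem_ball.1 hg
  refine ball_induction (P := fun _ g => ∀ i < n, g y i = g x i)
    (fun _ => inv_eq_self_of_mem_gens) (fun _ => h) ?_ hm
  rintro - s hs g hg
  rw [Equiv.Perm.mul_apply, Equiv.Perm.mul_apply]
  rcases hs with rfl | rfl | rfl | rfl
  · rintro (_ | i) hi
    · exact congrArg not (hg 0 hi)
    · exact hg (i + 1) hi
  all_goals exact fun i hi => kleinFun_congr i _ fun j hj => hg j (by omega)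

lemma apply_mem_cylinder_iff {g : Perm (ℕ → Bool)} (hg : g ∈ group) {n : ℕ} {x y : ℕ → Bool} :
    g y ∈ PiNat.cylinder (g x) n ↔ y ∈ PiNat.cylinder x n := by
  refine ⟨fun h => ?_, apply_congr hg⟩
  have := apply_congr (inv_mem hg) (x := g x) (y := g y) h
  simpa [PiNat.mem_cylinder_iff] using this

lemma preimage_cylinder {g : Perm (ℕ → Bool)} (hg : g ∈ group) (x : ℕ → Bool) (n : ℕ) :
    g ⁻¹' PiNat.cylinder (g x) n = PiNat.cylinder x n := by
  ext y; exact apply_mem_cylinder_iff hg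

/-- The commutator `[a, b]`. -/
def comm : Perm (ℕ → Bool) := flip * klein (true, true) * flip * klein (true, true)

lemma comm_mem : comm ∈ group :=
  mul_mem (mul_mem (mul_mem flip_mem (klein_mem _)) flip_mem) (klein_mem _)

lemma comm_eq_pair :
    comm = pair (klein (true, false) * flip) (flip * klein (true, false)) := by
  rw [comm, klein_eq_pair, flip_mul_pair, mul_assoc (pair _ _), flip_mul_flip, mul_one, pair_mul]
  rfl

lemma comm_apply_ne (x : ℕ → Bool) : comm x ≠ x := by
  intro h
  have h1 := congrFun h 1
  rw [comm_eq_pair, pair_apply] at h1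
  by_cases h0 : x 0 <;> simp [h0, flip_apply, klein_eq_pair (true, false), pair_apply] at h1

/-- The normal closure of `[a, b]` in the Grigorchuk group. -/
def branch : Subgroup (Perm (ℕ → Bool)) :=
  Subgroup.closure {k | ∃ g ∈ group, k = g * comm * g⁻¹}

lemma branch_le : branch ≤ group := by
  refine (Subgroup.closure_le _).2 ?_
  rintro _ ⟨g, hg, rfl⟩
  exact mul_mem (mul_mem hg comm_mem) (inv_mem hg)

lemma comm_mem_branch : comm ∈ branch := Subgroup.subset_closure ⟨1, one_mem _, by simp⟩

lemma conj_mem_branch {g k : Perm (ℕ → Bool)} (hg : g ∈ group) (hk : k ∈ branch) :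
    g * k * g⁻¹ ∈ branch := by
  induction hk using Subgroup.closure_induction with
  | mem k hk =>
    obtain ⟨h, hh, rfl⟩ := hk
    exact Subgroup.subset_closure ⟨g * h, mul_mem hg hh, by group⟩
  | one => simp
  | mul x y _ _ hx hy =>
    have := mul_mem hx hy
    rwa [show g * x * g⁻¹ * (g * y * g⁻¹) = g * (x * y) * g⁻¹ by group] at this
  | inv x _ hx =>
    have := inv_mem hx
    rwa [show (g * x * g⁻¹)⁻¹ = g * x⁻¹ * g⁻¹ by group] at this

lemma flip_mul_pair_mul_flip (f g : Perm (ℕ → Bool)) : flip * pair f g * flip = pair g f := by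
  rw [flip_mul_pair, mul_assoc, flip_mul_flip, mul_one]

lemma pair_one_comm_mem_branch : pair 1 comm ∈ branch := by
  set b := klein (true, true) with hb
  set d := klein (false, true) with hd
  have hbd : b * d * b = d := by rw [hb, hd, klein_mul, klein_mul]; rfl
  have hda : flip * d * flip = pair b 1 := by
    rw [hd, klein_eq_pair, flip_mul_pair_mul_flip]; rfl
  have hcomm : comm⁻¹ = b * flip * b * flip := by simp [comm, hb, mul_assoc]
  have h1 : pair comm 1 = b * (flip * d * flip) * (b * (flip * d * flip)) := by
    have : b = pair flip (klein (true, false)) := klein_eq_pair _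
    rw [hda, this, pair_mul, pair_mul, ← this, comm]
    simp [mul_assoc, ← hb]
  have h2 : comm⁻¹ * (flip * d * comm⁻¹ * (flip * d)⁻¹) = pair comm 1 := by
    calc comm⁻¹ * (flip * d * comm⁻¹ * (flip * d)⁻¹)
        = b * flip * b * (flip * flip) * d * b * flip * b * flip * (d * flip) := by
          rw [hcomm, mul_inv_rev, flip_inv, hd, klein_inv]
          simp only [mul_assoc]
      _ = b * flip * (b * d * b) * flip * b * flip * d * flip := by
          rw [flip_mul_flip]
          simp only [mul_assoc, one_mul]
      _ = _ := by
          rw [hbd, h1]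
          simp only [mul_assoc]
  have h3 : pair comm 1 ∈ branch := by
    rw [← h2]
    exact mul_mem (inv_mem comm_mem_branch)
      (conj_mem_branch (mul_mem flip_mem (klein_mem _)) (inv_mem comm_mem_branch))
  have := conj_mem_branch flip_mem h3
  rwa [flip_inv, flip_mul_pair_mul_flip] at this

lemma pair_one_mem_branch {k : Perm (ℕ → Bool)} (hk : k ∈ branch) : pair 1 k ∈ branch := by
  induction hk using Subgroup.closure_induction with
  | mem k hk =>
    obtain ⟨g, hg, rfl⟩ := hk
    obtain ⟨t, ht⟩ := exists_pair_mem hg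
    have := conj_mem_branch ht pair_one_comm_mem_branch
    rw [pair_inv, pair_mul, pair_mul] at this
    simpa using this
  | one => simp
  | mul x y _ _ hx hy =>
    have := mul_mem hx hy
    rwa [pair_mul, one_mul] at this
  | inv x _ hx =>
    have := inv_mem hx
    rwa [pair_inv, inv_one] at this

lemma pair_mem_branch_one {k : Perm (ℕ → Bool)} (hk : k ∈ branch) : pair k 1 ∈ branch := by
  have := conj_mem_branch flip_mem (pair_one_mem_branch hk)
  rwa [flip_inv, flip_mul_pair_mul_flip] at this

lemma exists_mem_branch (n : ℕ) (x : ℕ → Bool) :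
    ∃ k ∈ branch, (∀ y ∉ PiNat.cylinder x n, k y = y) ∧ k x ≠ x := by
  induction n generalizing x with
  | zero => exact ⟨comm, comm_mem_branch, by simp, comm_apply_ne x⟩
  | succ n ih =>
    obtain ⟨k, hk, hky, hkx⟩ := ih (tail x)
    have htail : ∀ y : ℕ → Bool, y 0 = x 0 → y ∉ PiNat.cylinder x (n + 1) →
        tail y ∉ PiNat.cylinder (tail x) n := by
      intro y h0 hy h
      refine hy ?_
      rintro (_ | i) hi
      · exact h0
      · exact h i (by omega)
    by_cases h : x 0
    · refine ⟨_, pair_one_mem_branch hk, fun y hy => ?_, fun hx => hkx ?_⟩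
      · by_cases h' : y 0
        · rw [pair_apply, if_pos h', hky _ (htail y (by rw [h, h']) hy), cons_tail]
        · rw [pair_apply, if_neg h', Equiv.Perm.one_apply, cons_tail]
      · rw [pair_apply, if_pos h] at hx
        simpa using congrArg tail hx
    · refine ⟨_, pair_mem_branch_one hk, fun y hy => ?_, fun hx => hkx ?_⟩
      · by_cases h' : y 0
        · rw [pair_apply, if_pos h', Equiv.Perm.one_apply, cons_tail]
        · rw [pair_apply, if_neg h', hky _ (htail y (by simp_all) hy), cons_tail]
      · rw [pair_apply, if_neg h] at hx
        simpa using congrArg tail hx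

lemma exists_mem_group_moving (n : ℕ) (x : ℕ → Bool) :
    ∃ g ∈ group, (∀ y ∉ PiNat.cylinder x n, g y = y) ∧ g x ≠ x := by
  obtain ⟨k, hk, h⟩ := exists_mem_branch n x
  exact ⟨k, branch_le hk, h⟩

/-! ### The uniform measure on binary sequences -/

/-- The fair coin. -/
noncomputable def coin : Measure Bool := (PMF.uniformOfFintype Bool).toMeasure

instance : IsProbabilityMeasure coin := PMF.toMeasure.isProbabilityMeasure _

/-- The uniform Bernoulli measure on binary sequences. -/
noncomputable def bernoulli : Measure (ℕ → Bool) := Measure.infinitePi fun _ => coin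

instance : IsProbabilityMeasure bernoulli := by unfold bernoulli; infer_instance

lemma bernoulli_cylinder (x : ℕ → Bool) (n : ℕ) :
    bernoulli (PiNat.cylinder x n) = 2⁻¹ ^ n := by
  rw [PiNat.cylinder_eq_pi, bernoulli, Measure.infinitePi_pi _ fun _ _ => measurableSet_singleton _]
  simp [coin]

lemma measurableSet_cylinder (x : ℕ → Bool) (n : ℕ) : MeasurableSet (PiNat.cylinder x n) :=
  (PiNat.isOpen_cylinder _ x n).measurableSet

lemma ext_cylinder {μ ν : Measure (ℕ → Bool)} [IsFiniteMeasure μ]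
    (h : ∀ x n, μ (PiNat.cylinder x n) = ν (PiNat.cylinder x n)) : μ = ν := by
  have hb := PiNat.isTopologicalBasis_cylinders fun _ : ℕ => Bool
  refine ext_of_generate_finite _
    ((BorelSpace.measurable_eq (α := ℕ → Bool)).trans hb.borel_eq_generateFrom) ?_ ?_ ?_
  · rintro _ ⟨x, m, rfl⟩ _ ⟨y, n, rfl⟩ ⟨z, hz, hz'⟩
    rw [PiNat.mem_cylinder_iff_eq] at hz hz'
    rw [← hz, ← hz']
    rcases le_total m n with hmn | hmn
    · exact ⟨z, n, Set.inter_eq_right.2 (PiNat.cylinder_anti z hmn)⟩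
    · exact ⟨z, m, Set.inter_eq_left.2 (PiNat.cylinder_anti z hmn)⟩
  · rintro _ ⟨x, n, rfl⟩
    exact h x n
  · simpa using h (fun _ => true) 0

lemma measurable_of_mem {g : Perm (ℕ → Bool)} (hg : g ∈ group) : Measurable g := by
  refine Continuous.measurable ?_
  refine (PiNat.isTopologicalBasis_cylinders fun _ : ℕ => Bool).continuous_iff.2 ?_
  rintro _ ⟨x, n, rfl⟩
  rw [← g.apply_symm_apply x, preimage_cylinder hg]
  exact PiNat.isOpen_cylinder _ _ _

lemma map_bernoulli {g : Perm (ℕ → Bool)} (hg : g ∈ group) : bernoulli.map g = bernoulli := by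
  have : IsProbabilityMeasure (bernoulli.map g) :=
    Measure.isProbabilityMeasure_map (measurable_of_mem hg).aemeasurable
  refine ext_cylinder fun x n => ?_
  rw [Measure.map_apply (measurable_of_mem hg) (measurableSet_cylinder x n)]
  conv_lhs => rw [← g.apply_symm_apply x, preimage_cylinder hg]
  rw [bernoulli_cylinder, bernoulli_cylinder]

lemma bernoulli_preimage {g : Perm (ℕ → Bool)} (hg : g ∈ group) {s : Set (ℕ → Bool)}
    (hs : MeasurableSet s) : bernoulli (g ⁻¹' s) = bernoulli s := by
  rw [← Measure.map_apply (measurable_of_mem hg) hs, map_bernoulli hg]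

instance : NullSingletonClass bernoulli where
  measure_singleton x := by
    have h1 : Filter.Tendsto (fun n : ℕ => (2⁻¹ : ENNReal) ^ n) Filter.atTop (nhds 0) :=
      ENNReal.tendsto_pow_atTop_nhds_zero_of_lt_one (by simp)
    refine le_antisymm (ge_of_tendsto' h1 fun n => ?_) zero_le
    rw [← bernoulli_cylinder x n]
    exact measure_mono (Set.singleton_subset_iff.2 (PiNat.self_mem_cylinder x n))

/-- The Grigorchuk group acts ergodically on binary sequences. -/
lemma bernoulli_eq_zero_or_one {s : Set (ℕ → Bool)} (hs : MeasurableSet s)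
    (hinv : ∀ g ∈ group, g ⁻¹' s = s) : bernoulli s = 0 ∨ bernoulli s = 1 := by
  have hsame : ∀ n x y,
      bernoulli (PiNat.cylinder x n ∩ s) = bernoulli (PiNat.cylinder y n ∩ s) := by
    intro n x y
    obtain ⟨g, hg, hgy⟩ := exists_mem_agree n x y
    have h1 : PiNat.cylinder (g x) n = PiNat.cylinder y n := PiNat.mem_cylinder_iff_eq.1 hgy
    rw [← h1, ← bernoulli_preimage hg ((measurableSet_cylinder (g x) _).inter hs), Set.preimage_inter,
      preimage_cylinder hg, hinv g hg]
  have hcyl : ∀ n x, bernoulli (PiNat.cylinder x n ∩ s) = 2⁻¹ ^ n * bernoulli s := by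
    intro n
    induction n with
    | zero => simp
    | succ n ih =>
      intro x
      have hunion : PiNat.cylinder x n ∩ s = (PiNat.cylinder x (n + 1) ∩ s) ∪
          (PiNat.cylinder (Function.update x n (!x n)) (n + 1) ∩ s) := by
        rw [← Set.union_inter_distrib_right]
        congr 1
        ext y
        simp only [PiNat.mem_cylinder_iff, Set.mem_union, Nat.forall_lt_succ_right,
          Function.update_self]
        have : ∀ i < n, Function.update x n (!x n) i = x i := fun i hi =>
          Function.update_of_ne hi.ne _ _
        constructor
        · intro h
          by_cases hn : y n = x n
          · exact Or.inl ⟨h, hn⟩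
          · exact Or.inr ⟨fun i hi => by rw [this i hi, h i hi], Bool.eq_not_of_ne hn⟩
        · rintro (h | h)
          · exact h.1
          · exact fun i hi => by rw [h.1 i hi, this i hi]
      have hdisj : Disjoint (PiNat.cylinder x (n + 1) ∩ s)
          (PiNat.cylinder (Function.update x n (!x n)) (n + 1) ∩ s) := by
        rw [Set.disjoint_left]
        rintro y ⟨h, -⟩ ⟨h', -⟩
        have h1 := h n (by omega)
        have h2 := h' n (by omega)
        rw [h1] at h2
        simp at h2
      have h2 := ih x
      rw [hunion, measure_union hdisj ((measurableSet_cylinder _ _).inter hs),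
        hsame (n + 1) (Function.update _ _ _) x, ← two_mul] at h2
      rw [pow_succ, mul_right_comm, ← h2, mul_comm (2 * _), ← mul_assoc,
        ENNReal.inv_mul_cancel (by simp) (by simp), one_mul]
  have hrestrict : bernoulli.restrict s = bernoulli s • bernoulli := by
    refine ext_cylinder fun x n => ?_
    rw [Measure.restrict_apply (measurableSet_cylinder x n), hcyl, Measure.smul_apply, smul_eq_mul,
      bernoulli_cylinder, mul_comm]
  have hsq : bernoulli s = bernoulli s * bernoulli s := by
    conv_lhs => rw [← Measure.restrict_apply_self, hrestrict]
    rfl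
  by_cases h0 : bernoulli s = 0
  · exact Or.inl h0
  · refine Or.inr ?_
    have h1 : bernoulli s * 1 = bernoulli s * bernoulli s := by rw [mul_one]; exact hsq
    exact ((ENNReal.mul_right_inj h0 (measure_ne_top _ _)).1 h1).symm

end Grigorchuk

/-! ### The space of subgroups of a countable group -/

section SubgroupSpace

variable {G : Type*} [Group G]

lemma mem_conjSubgroup {g h : G} {N : Subgroup G} :
    h ∈ conjSubgroup g N ↔ g * h * g⁻¹ ∈ N := by
  rw [conjSubgroup, Subgroup.mem_map]
  constructor
  · rintro ⟨k, hk, rfl⟩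
    simpa [mul_assoc] using hk
  · exact fun hk => ⟨_, hk, by simp [mul_assoc]⟩

variable [Countable G]

lemma subgroup_measurableSpace_eq :
    (inferInstance : MeasurableSpace (Subgroup G)) =
      MeasurableSpace.comap subgroupChar MeasurableSpace.pi :=
  borel_comap.trans (congrArg _ (BorelSpace.measurable_eq (α := G → Bool)).symm)

lemma measurable_subgroup_iff {α : Type*} [MeasurableSpace α] {f : α → Subgroup G} :
    Measurable f ↔ ∀ g, MeasurableSet {x | g ∈ f x} := by
  have h := subgroup_measurableSpace_eq (G := G)
  have hset : ∀ g, {x | g ∈ f x} = (fun x => (subgroupChar ∘ f) x g) ⁻¹' {true} := by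
    intro g
    ext x
    simp [subgroupChar]
  constructor
  · intro hf g
    rw [hset]
    have : Measurable (subgroupChar (G := G)) := by
      have h1 := comap_measurable (m := MeasurableSpace.pi) (subgroupChar (G := G))
      rwa [← h] at h1
    exact (measurable_pi_iff.1 (this.comp hf) g) (measurableSet_singleton _)
  · intro hf
    have : @Measurable _ _ _ (MeasurableSpace.comap subgroupChar MeasurableSpace.pi) f := by
      refine measurable_comap_iff.2 (measurable_pi_iff.2 fun g => measurable_to_bool ?_)
      rw [← hset]
      exact hf g
    rwa [← h] at this

lemma measurableSet_mem_subgroup (g : G) : MeasurableSet {N : Subgroup G | g ∈ N} :=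
  measurable_subgroup_iff.1 measurable_id g

lemma measurableSet_subset_subgroup (s : Set G) : MeasurableSet {N : Subgroup G | s ⊆ N} := by
  have : {N : Subgroup G | s ⊆ N} = ⋂ g ∈ s, {N | g ∈ N} := by
    ext N; simp [Set.subset_def]
  rw [this]
  exact MeasurableSet.biInter s.to_countable fun g _ => measurableSet_mem_subgroup g

lemma measurableSet_singleton_subgroup (N : Subgroup G) : MeasurableSet {N} := by
  have : ({N} : Set (Subgroup G)) = ⋂ g : G, {M | g ∈ M ↔ g ∈ N} := by
    ext M; simp [SetLike.ext_iff]
  rw [this]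
  exact MeasurableSet.iInter fun g => (measurableSet_mem_subgroup g).iff (MeasurableSet.const _)

lemma measurable_conjSubgroup (g : G) : Measurable fun N : Subgroup G => conjSubgroup g N := by
  refine measurable_subgroup_iff.2 fun h => ?_
  simp only [mem_conjSubgroup]
  exact measurableSet_mem_subgroup _

lemma ext_of_subset_subgroup {μ ν : Measure (Subgroup G)} [IsFiniteMeasure μ]
    (h : ∀ F : Finset G, μ {N | (F : Set G) ⊆ N} = ν {N | (F : Set G) ⊆ N}) : μ = ν := by
  classical
  refine ext_of_generate_finite (Set.range fun F : Finset G => {N : Subgroup G | (F : Set G) ⊆ N})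
    (le_antisymm ?_ ?_) ?_ ?_ ?_
  · have : @Measurable _ _ (MeasurableSpace.generateFrom
        (Set.range fun F : Finset G => {N : Subgroup G | (F : Set G) ⊆ N})) _ id := by
      refine @measurable_subgroup_iff G _ _ _ (_) _ |>.2 fun g => ?_
      refine MeasurableSpace.measurableSet_generateFrom ⟨{g}, ?_⟩
      ext N; simp
    exact fun s hs => this hs
  · refine MeasurableSpace.generateFrom_le ?_
    rintro _ ⟨F, rfl⟩
    exact measurableSet_subset_subgroup _
  · rintro _ ⟨F, rfl⟩ _ ⟨F', rfl⟩ -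
    refine ⟨F ∪ F', ?_⟩
    ext N; simp
  · rintro _ ⟨F, rfl⟩
    exact h F
  · simpa using h ∅

lemma mk_probabilityMeasure_subgroup_le (G : Type) [Group G] [Countable G] :
    Cardinal.mk {μ : Measure (Subgroup G) | IsProbabilityMeasure μ} ≤ Cardinal.continuum := by
  let f : {μ : Measure (Subgroup G) | IsProbabilityMeasure μ} → Finset G → ℝ :=
    fun μ F => (μ.1 {N | (F : Set G) ⊆ N}).toReal
  have hf : Function.Injective f := by
    rintro ⟨μ, hμ⟩ ⟨ν, hν⟩ h
    have : IsProbabilityMeasure μ := hμ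
    have : IsProbabilityMeasure ν := hν
    refine Subtype.ext (ext_of_subset_subgroup fun F => ?_)
    exact (ENNReal.toReal_eq_toReal_iff' (measure_ne_top _ _) (measure_ne_top _ _)).1
      (congrFun h F)
  refine (Cardinal.mk_le_of_injective hf).trans ?_
  rw [← Cardinal.power_def, Cardinal.mk_real]
  calc _ ≤ Cardinal.continuum ^ Cardinal.aleph0 :=
        Cardinal.power_le_power_left Cardinal.continuum_ne_zero Cardinal.mk_le_aleph0
    _ = _ := Cardinal.continuum_power_aleph0

end SubgroupSpace

namespace Grigorchuk

instance : Countable group := by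
  have : (group : Set (Perm (ℕ → Bool))) = ⋃ n, ball gens n := by
    ext g
    rw [Set.mem_iUnion]
    exact mem_closure_iff_exists_mem_ball
  refine Set.Countable.to_subtype (s := (group : Set (Perm (ℕ → Bool)))) ?_
  rw [this]
  exact Set.countable_iUnion fun n => (finite_ball n).countable

lemma ncard_ball_group (n : ℕ) :
    Nat.card (ball (Subtype.val ⁻¹' gens : Set group) n) = (ball gens n).ncard := by
  have h : Subtype.val '' (Subtype.val ⁻¹' gens : Set group) = gens :=
    Set.image_preimage_eq_of_subset fun g hg => ⟨⟨g, Subgroup.subset_closure hg⟩, rfl⟩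
  have h2 := image_ball (S := (Subtype.val ⁻¹' gens : Set group)) group.subtype n
  rw [Subgroup.coe_subtype, h] at h2
  rw [← h2, Set.ncard_image_of_injective _ Subtype.val_injective, Nat.card_coe_set_eq]

/-! ### Random fixators -/

/-- The closed set consisting of `x` and of all sequences whose first difference with `x` occurs
at a position in `A`. -/
def nearby (A : Set ℕ) (x : ℕ → Bool) : Set (ℕ → Bool) :=
  {y | y = x ∨ ∃ n ∈ A, (∀ i < n, y i = x i) ∧ y n ≠ x n}

lemma apply_mem_nearby {A : Set ℕ} {g : Perm (ℕ → Bool)} (hg : g ∈ group) {x y : ℕ → Bool}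
    (hy : y ∈ nearby A x) : g y ∈ nearby A (g x) := by
  rcases hy with rfl | ⟨n, hn, h, hne⟩
  · exact Or.inl rfl
  · refine Or.inr ⟨n, hn, apply_congr hg h, fun heq => hne ?_⟩
    have h1 : g y ∈ PiNat.cylinder (g x) (n + 1) :=
      Nat.forall_lt_succ_right.2 ⟨apply_congr hg h, heq⟩
    exact (apply_mem_cylinder_iff hg).1 h1 n (by omega)

lemma apply_inv_mem_nearby_iff {A : Set ℕ} {g : Perm (ℕ → Bool)} (hg : g ∈ group)
    {x y : ℕ → Bool} : y ∈ nearby A (g⁻¹ x) ↔ g y ∈ nearby A x := by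
  constructor
  · intro h
    simpa using apply_mem_nearby hg h
  · intro h
    simpa using apply_mem_nearby (inv_mem hg) h

/-- First differences are unique. -/
lemma notMem_nearby {A : Set ℕ} {x y : ℕ → Bool} {k : ℕ} (hk : k ∉ A) (h : ∀ i < k, y i = x i)
    (hne : y k ≠ x k) : y ∉ nearby A x := by
  rintro (rfl | ⟨n, hn, h', hne'⟩)
  · exact hne rfl
  · rcases lt_trichotomy n k with hnk | rfl | hnk
    · exact hne' (h n hnk)
    · exact hk hn
    · exact hne (h' k hnk)

/-- The pointwise stabilizer of `nearby A x`. -/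
def fixer (A : Set ℕ) (x : ℕ → Bool) : Subgroup group where
  carrier := {g | ∀ y ∈ nearby A x, (g : Perm (ℕ → Bool)) y = y}
  one_mem' := fun _ _ => rfl
  mul_mem' := by
    intro g h hg hh y hy
    rw [Subgroup.coe_mul, Equiv.Perm.mul_apply, hh y hy, hg y hy]
  inv_mem' := by
    intro g hg y hy
    rw [Subgroup.coe_inv, Equiv.Perm.inv_eq_iff_eq, hg y hy]

lemma mem_fixer {A : Set ℕ} {x : ℕ → Bool} {g : group} :
    g ∈ fixer A x ↔ ∀ y ∈ nearby A x, (g : Perm (ℕ → Bool)) y = y := Iff.rfl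

lemma conjSubgroup_fixer (A : Set ℕ) (x : ℕ → Bool) (g : group) :
    conjSubgroup g (fixer A x) = fixer A ((g : Perm (ℕ → Bool))⁻¹ x) := by
  ext h
  simp only [mem_conjSubgroup, mem_fixer, apply_inv_mem_nearby_iff g.2, Subgroup.coe_mul,
    Subgroup.coe_inv, Equiv.Perm.mul_apply]
  constructor
  · intro H y hy
    have := H _ hy
    rw [← Equiv.Perm.mul_apply (g : Perm (ℕ → Bool))⁻¹, inv_mul_cancel, Equiv.Perm.one_apply] at this
    exact (g : Perm (ℕ → Bool)).injective this
  · intro H y hy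
    rw [H _ (by simpa using hy), ← Equiv.Perm.mul_apply, mul_inv_cancel, Equiv.Perm.one_apply]

lemma measurable_fixer (A : Set ℕ) : Measurable (fixer A) := by
  refine measurable_subgroup_iff.2 fun g => ?_
  rw [← MeasurableSet.compl_iff]
  refine IsOpen.measurableSet ?_
  refine (PiNat.isTopologicalBasis_cylinders fun _ : ℕ => Bool).isOpen_iff.2 fun x hx => ?_
  simp only [Set.mem_compl_iff, Set.mem_ofPred_eq, mem_fixer, not_forall] at hx
  obtain ⟨y, hy, hgy⟩ := hx
  rcases hy with rfl | ⟨n, hn, h, hne⟩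
  · obtain ⟨i, hi⟩ := Function.ne_iff.1 hgy
    refine ⟨_, ⟨y, i + 1, rfl⟩, PiNat.self_mem_cylinder _ _, fun x' hx' H => hi ?_⟩
    have h1 := congrFun (H x' (Or.inl rfl)) i
    rwa [apply_congr g.2 hx' i (by omega), hx' i (by omega)] at h1
  · refine ⟨_, ⟨x, n + 1, rfl⟩, PiNat.self_mem_cylinder _ _, fun x' hx' H => hgy ?_⟩
    refine H y (Or.inr ⟨n, hn, fun i hi => ?_, ?_⟩)
    · rw [h i hi, hx' i (by omega)]
    · rwa [hx' n (by omega)]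

lemma fixer_ne {A : Set ℕ} {x y z : ℕ → Bool} {k : ℕ} (hz : z ∈ nearby A x) (hk : k ∉ A)
    (h : ∀ i < k, z i = y i) (hne : z k ≠ y k) : fixer A x ≠ fixer A y := by
  intro heq
  obtain ⟨g, hg, hfix, hgz⟩ := exists_mem_group_moving (k + 1) z
  have : (⟨g, hg⟩ : group) ∈ fixer A y := by
    intro w hw
    refine hfix w fun hwz => notMem_nearby hk (fun i hi => ?_) ?_ hw
    · rw [hwz i (by omega), h i hi]
    · rwa [hwz k (by omega)]
  rw [← heq] at this
  exact hgz (this z hz)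

lemma fixer_injective {A : Set ℕ} (hA : ∀ n, ∃ k, n < k ∧ k ∉ A) :
    Function.Injective (fixer A) := by
  intro x y hxy
  by_contra hne
  have h1 : ∀ i < PiNat.firstDiff x y, x i = y i := fun i hi =>
    PiNat.apply_eq_of_lt_firstDiff hi
  have h2 := PiNat.apply_firstDiff_ne hne
  set n := PiNat.firstDiff x y
  by_cases hn : n ∈ A
  · obtain ⟨k, hnk, hk⟩ := hA n
    refine fixer_ne (z := Function.update y k (!y k)) (Or.inr ⟨n, hn, fun i hi => ?_, ?_⟩) hk
      (fun i hi => Function.update_of_ne hi.ne _ _) (by simp) hxy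
    · rw [Function.update_of_ne (by omega), h1 i hi]
    · rw [Function.update_of_ne (by omega)]
      exact h2.symm
  · exact fixer_ne (Or.inl rfl) hn h1 h2 hxy

/-- The law of the pointwise stabilizer of `nearby A x` for a uniformly random `x`. -/
noncomputable def law (A : Set ℕ) : Measure (Subgroup group) := bernoulli.map (fixer A)

lemma isProbabilityMeasure_law (A : Set ℕ) : IsProbabilityMeasure (law A) :=
  Measure.isProbabilityMeasure_map (measurable_fixer A).aemeasurable

lemma law_singleton {A : Set ℕ} (hA : ∀ n, ∃ k, n < k ∧ k ∉ A) (N : Subgroup group) :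
    law A {N} = 0 := by
  rw [law, Measure.map_apply (measurable_fixer A) (measurableSet_singleton_subgroup N)]
  exact Set.Subsingleton.measure_zero
    (Set.subsingleton_singleton.preimage (fixer_injective hA)) _

lemma map_conjSubgroup_law (A : Set ℕ) (g : group) :
    (law A).map (fun N => conjSubgroup g N) = law A := by
  have hg := inv_mem g.2
  have : (fun N => conjSubgroup g N) ∘ fixer A = fixer A ∘ ⇑((g : Perm (ℕ → Bool))⁻¹) :=
    funext fun x => conjSubgroup_fixer A x g
  rw [law, Measure.map_map (measurable_conjSubgroup g) (measurable_fixer A), this,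
    ← Measure.map_map (measurable_fixer A) (measurable_of_mem hg), map_bernoulli hg]

lemma law_eq_zero_or_one (A : Set ℕ) {s : Set (Subgroup group)} (hs : MeasurableSet s)
    (hinv : ∀ g : group, (fun N => conjSubgroup g N) ⁻¹' s = s) : law A s = 0 ∨ law A s = 1 := by
  rw [law, Measure.map_apply (measurable_fixer A) hs]
  refine bernoulli_eq_zero_or_one (measurable_fixer A hs) fun g hg => ?_
  ext x
  have := Set.ext_iff.1 (hinv ⟨g, hg⟩⁻¹) (fixer A x)
  simpa [conjSubgroup_fixer] using this

/-- The elements of the Grigorchuk group supported in the cylinder of sequences starting with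
`n` ones. -/
def rist (n : ℕ) : Set group :=
  {g | ∀ y ∉ PiNat.cylinder (fun _ => true) n, (g : Perm (ℕ → Bool)) y = y}

lemma rist_subset_fixer_iff {A : Set ℕ} {x : ℕ → Bool} {n : ℕ} :
    rist n ⊆ fixer A x ↔ ∀ y ∈ nearby A x, y ∉ PiNat.cylinder (fun _ => true) n := by
  constructor
  · intro h y hy hyn
    obtain ⟨g, hg, hfix, hgy⟩ := exists_mem_group_moving n y
    rw [PiNat.mem_cylinder_iff_eq.1 hyn] at hfix
    exact hgy (h (show (⟨g, hg⟩ : group) ∈ rist n from hfix) y hy)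
  · exact fun h g hg y hy => hg y (h y hy)

lemma law_rist_eq_zero_iff {A : Set ℕ} {m : ℕ} :
    law A ({N | rist (m + 1) ⊆ N} \ {N | rist m ⊆ N}) = 0 ↔ m ∈ A := by
  rw [law, Measure.map_apply (measurable_fixer A)
    ((measurableSet_subset_subgroup _).diff (measurableSet_subset_subgroup _))]
  constructor
  · intro h0
    by_contra hm
    have hsub : PiNat.cylinder (Function.update (fun _ => true) m false) (m + 1) ⊆
        fixer A ⁻¹' ({N | rist (m + 1) ⊆ N} \ {N | rist m ⊆ N}) := by
      intro x hx
      have h1 : ∀ i < m, x i = true := fun i hi => by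
        rw [hx i (by omega), Function.update_of_ne hi.ne]
      have h2 : x m = false := by rw [hx m (by omega), Function.update_self]
      refine ⟨rist_subset_fixer_iff.2 fun y hy hyn => ?_, fun h =>
        rist_subset_fixer_iff.1 h x (Or.inl rfl) h1⟩
      refine notMem_nearby hm (fun i hi => ?_) ?_ hy
      · rw [h1 i hi, hyn i (by omega)]
      · rw [h2, hyn m (by omega)]
        simp
    have := measure_mono_null hsub h0
    rw [bernoulli_cylinder] at this
    simp at this
  · intro hm
    suffices fixer A ⁻¹' ({N | rist (m + 1) ⊆ N} \ {N | rist m ⊆ N}) = ∅ by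
      rw [this, measure_empty]
    refine Set.eq_empty_of_forall_notMem fun x ⟨h1, h2⟩ => h2 ?_
    have h1' := rist_subset_fixer_iff.1 h1
    refine rist_subset_fixer_iff.2 fun y hy hym => ?_
    have hones := fun h => h1' (fun _ => true) h (PiNat.self_mem_cylinder _ _)
    by_cases hx : ∀ i < m, x i = true
    · by_cases hxm : x m = true
      · exact h1' x (Or.inl rfl) (Nat.forall_lt_succ_right.2 ⟨hx, hxm⟩)
      · exact hones (Or.inr ⟨m, hm, fun i hi => (hx i hi).symm, fun h => hxm h.symm⟩)
    · rcases hy with rfl | ⟨n, hn, h, hne⟩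
      · exact hx hym
      · rcases lt_or_ge n m with hnm | hnm
        · refine hones (Or.inr ⟨n, hn, fun i hi => ?_, ?_⟩)
          · rw [← h i hi, hym i (by omega)]
          · rwa [hym n hnm] at hne
        · exact hx fun i hi => by rw [← h i (by omega), hym i hi]

lemma law_injective : Function.Injective law := by
  intro A B h
  ext m
  rw [← law_rist_eq_zero_iff, ← law_rist_eq_zero_iff, h]

end Grigorchuk

/-- There exists a finitely generated group `G` of intermediate growth
such that the set of continuous ergodic invariant random subgroups of `G` — atomless,
ergodic, conjugation-invariant Borel probability measures on `S(G)` — has cardinality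
`2^{ℵ₀}` (the continuum). -/
theorem stmt_19 :
    ∃ (G : Type) (_ : Group G) (S : Set G),
      S.Finite ∧ Subgroup.closure S = ⊤ ∧
      (∀ d : ℕ, ∃ n : ℕ, n ^ d < Nat.card (ball S n)) ∧
      Filter.Tendsto (fun n : ℕ => (Nat.card (ball S n) : ℝ) ^ ((n : ℝ)⁻¹))
        Filter.atTop (nhds 1) ∧
      Cardinal.mk
        {μ : Measure (Subgroup G) |
          IsProbabilityMeasure μ ∧
          (∀ N : Subgroup G, μ {N} = 0) ∧
          (∀ g : G, μ.map (fun N => conjSubgroup g N) = μ) ∧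
          (∀ s : Set (Subgroup G), MeasurableSet s →
            (∀ g : G, (fun N => conjSubgroup g N) ⁻¹' s = s) → μ s = 0 ∨ μ s = 1)}
        = Cardinal.continuum := by
  refine ⟨Grigorchuk.group, inferInstance, Subtype.val ⁻¹' Grigorchuk.gens,
    Grigorchuk.finite_gens.preimage Subtype.val_injective.injOn,
    Subgroup.closure_closure_coe_preimage, fun d => ?_, ?_, le_antisymm ?_ ?_⟩
  · simpa only [Grigorchuk.ncard_ball_group] using Grigorchuk.superpolynomial d
  · simpa only [Grigorchuk.ncard_ball_group] using Grigorchuk.subexponential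
  · exact (Cardinal.mk_le_mk_of_subset fun _ h => h.1).trans
      (mk_probabilityMeasure_subgroup_le Grigorchuk.group)
  · have hA : ∀ (s : Set ℕ) (n : ℕ), ∃ k, n < k ∧ k ∉ (2 * ·) '' s := by
      refine fun s n => ⟨2 * n + 1, by omega, ?_⟩
      rintro ⟨m, -, hm⟩
      dsimp only at hm
      omega
    rw [← Cardinal.mk_set_nat]
    refine Cardinal.mk_le_of_injective (f := fun s : Set ℕ => ⟨Grigorchuk.law ((2 * ·) '' s),
      Grigorchuk.isProbabilityMeasure_law _, Grigorchuk.law_singleton (hA s),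
      Grigorchuk.map_conjSubgroup_law _, fun _ => Grigorchuk.law_eq_zero_or_one _⟩) ?_
    intro s t h
    exact Set.image_injective.2 (mul_right_injective₀ two_ne_zero)
      (Grigorchuk.law_injective (congrArg Subtype.val h))
end
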